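/- arXiv:1610.01324 — 4 statements merged into one kernel-verified Lean document; each statement's English description precedes it below -/
import Mathlib

section
/- For every integer p ≥ 0 there exist p+1 nodes −1 < t_0 < t_1 < ⋯ < t_p = 1 (so that the right endpoint 1 is a node) and positive weights ω_0, …, ω_p such that ∑_{i=0}^{p} ω_i q(t_i) = ∫_{−1}^{1} q(t) dt for every real polynomial q of degree at most 2p (the right Gauß–Radau quadrature rule with p+1 points). -/
open Polynomial

/-- The linear functional `q ↦ ∫ x in a..b, q x` on real polynomials. -/
noncomputable def polyIntegral (a b : ℝ) : ℝ[X] →ₗ[ℝ] ℝ where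
  toFun q := ∫ x in a..b, q.eval x
  map_add' q r := by
    simp only [eval_add]
    exact intervalIntegral.integral_add (q.continuous.intervalIntegrable _ _)
      (r.continuous.intervalIntegrable _ _)
  map_smul' c q := by
    simp [eval_smul]

theorem polyIntegral_apply (a b : ℝ) (q : ℝ[X]) :
    polyIntegral a b q = ∫ x in a..b, q.eval x := rfl

theorem polyIntegral_pos {a b : ℝ} (hab : a < b) {q : ℝ[X]} (hq : q ≠ 0)
    (hnn : ∀ x ∈ Set.Ioc a b, 0 ≤ q.eval x) : 0 < polyIntegral a b q := by
  obtain ⟨x, hx, hxq⟩ := (Set.Ioo_infinite hab).exists_notMem_finset q.roots.toFinset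
  refine intervalIntegral.integral_pos hab q.continuous.continuousOn hnn
    ⟨x, Set.Ioo_subset_Icc_self hx, (hnn x (Set.Ioo_subset_Ioc_self hx)).lt_of_ne' ?_⟩
  simpa [hq] using hxq

/-- A nonzero polynomial of degree at most `p` orthogonal to all polynomials of degree less
than `p` for the weight `g` on `[a, b]`. -/
theorem exists_orthogonal_polynomial (a b : ℝ) (g : ℝ[X]) (p : ℕ) :
    ∃ f : ℝ[X], f ≠ 0 ∧ f.degree < (p + 1 : ℕ) ∧
      ∀ q : ℝ[X], q.degree < p → polyIntegral a b (g * (f * q)) = 0 := by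
  let B := ((LinearMap.mul ℝ ℝ[X]).compr₂
    (polyIntegral a b ∘ₗ LinearMap.mulLeft ℝ g)).domRestrict₁₂ (degreeLT ℝ (p + 1)) (degreeLT ℝ p)
  have : FiniteDimensional ℝ (degreeLT ℝ (p + 1)) := (degreeLTEquiv ℝ (p + 1)).symm.finiteDimensional
  have : FiniteDimensional ℝ (degreeLT ℝ p) := (degreeLTEquiv ℝ p).symm.finiteDimensional
  have hB : LinearMap.ker B ≠ ⊥ := by
    apply LinearMap.ker_ne_bot_of_finrank_lt
    change Module.finrank ℝ (Module.Dual ℝ (degreeLT ℝ p)) < _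
    rw [Subspace.dual_finrank_eq, (degreeLTEquiv ℝ p).finrank_eq,
      (degreeLTEquiv ℝ (p + 1)).finrank_eq]
    simp
  obtain ⟨f, hf, hf0⟩ := Submodule.exists_mem_ne_zero_of_ne_bot hB
  refine ⟨f, by simpa using hf0, mem_degreeLT.1 f.2, fun q hq => ?_⟩
  exact LinearMap.congr_fun (LinearMap.mem_ker.1 hf) ⟨q, mem_degreeLT.2 hq⟩

/-- Splitting off the sign changes of a polynomial in an open interval. -/
theorem exists_eq_nodal_mul_constant_sign {a b : ℝ} (n : ℕ) :
    ∀ f : ℝ[X], f ≠ 0 → f.natDegree = n → ∃ (S : Finset ℝ) (h : ℝ[X]),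
      (∀ x ∈ S, x ∈ Set.Ioo a b) ∧ f = Lagrange.nodal S id * h ∧
      ((∀ x ∈ Set.Ioo a b, 0 ≤ h.eval x) ∨ ∀ x ∈ Set.Ioo a b, 0 ≤ (-h).eval x) := by
  induction n with
  | zero =>
    intro f _ hf
    rw [natDegree_eq_zero] at hf
    obtain ⟨c, rfl⟩ := hf
    refine ⟨∅, C c, by simp, by simp, ?_⟩
    rcases le_total 0 c with hc | hc
    · exact Or.inl fun x _ => by simpa using hc
    · exact Or.inr fun x _ => by simpa using hc
  | succ n ih =>
    intro f hf0 hf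
    by_cases hroot : ∃ r ∈ Set.Ioo a b, f.eval r = 0
    · obtain ⟨r, hr, hfr⟩ := hroot
      obtain ⟨g, rfl⟩ := dvd_iff_isRoot.2 hfr
      have hg0 : g ≠ 0 := right_ne_zero_of_mul hf0
      rw [natDegree_mul (X_sub_C_ne_zero r) hg0, natDegree_X_sub_C] at hf
      obtain ⟨S, h, hS, rfl, hh⟩ := ih g hg0 (by lia)
      by_cases hrS : r ∈ S
      · refine ⟨S.erase r, (X - C r) ^ 2 * h, fun x hx => hS x (Finset.mem_of_mem_erase hx), ?_, ?_⟩
        · rw [Lagrange.nodal_eq_mul_nodal_erase hrS, id]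
          ring
        · refine hh.imp (fun hh x hx => ?_) fun hh x hx => ?_
          · simpa using mul_nonneg (sq_nonneg (x - r)) (hh x hx)
          · simpa using mul_nonneg (sq_nonneg (x - r)) (hh x hx)
      · refine ⟨insert r S, h, ?_, ?_, hh⟩
        · simpa [hS] using ⟨hr, hS⟩
        · rw [Lagrange.nodal_insert_eq_nodal hrS, id, mul_assoc]
    · push Not at hroot
      refine ⟨∅, f, by simp, by simp, ?_⟩
      by_contra! hcon
      obtain ⟨⟨x, hx, hfx⟩, y, hy, hfy⟩ := hcon
      rw [eval_neg, neg_lt_zero] at hfy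
      obtain ⟨z, hz, hfz⟩ := isPreconnected_Ioo.intermediate_value hx hy
        f.continuous.continuousOn ⟨hfx.le, hfy.le⟩
      exact hroot z hz hfz

/-- The interior Gauß–Radau nodes: the roots of an orthogonal polynomial for the weight `b - x`. -/
theorem exists_radau_nodes {a b : ℝ} (hab : a < b) (p : ℕ) :
    ∃ S : Finset ℝ, S.card = p ∧ (∀ x ∈ S, x ∈ Set.Ioo a b) ∧
      ∀ q : ℝ[X], q.degree < p →
        polyIntegral a b ((C b - X) * (Lagrange.nodal S id * q)) = 0 := by
  have hX : (C b - X : ℝ[X]) ≠ 0 := by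
    rw [← neg_sub]
    exact neg_ne_zero.2 (X_sub_C_ne_zero b)
  obtain ⟨f, hf0, hfdeg, horth⟩ := exists_orthogonal_polynomial a b (C b - X) p
  obtain ⟨S, h, hS, rfl, hh⟩ :=
    exists_eq_nodal_mul_constant_sign (a := a) (b := b) f.natDegree f hf0 rfl
  have hh0 : h ≠ 0 := right_ne_zero_of_mul hf0
  have hN0 : Lagrange.nodal S (id : ℝ → ℝ) ≠ 0 := left_ne_zero_of_mul hf0
  have key : ∀ k : ℝ[X], k ≠ 0 → (∀ x ∈ Set.Ioo a b, 0 ≤ k.eval x) →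
      0 < polyIntegral a b ((C b - X) * (Lagrange.nodal S id * k * Lagrange.nodal S id)) := by
    intro k hk0 hk
    refine polyIntegral_pos hab (mul_ne_zero hX (mul_ne_zero (mul_ne_zero hN0 hk0) hN0)) ?_
    intro x hx
    rcases hx.2.eq_or_lt with rfl | hxb
    · simp
    · simp only [eval_mul, eval_sub, eval_C, eval_X]
      rw [mul_right_comm (eval x _)]
      exact mul_nonneg (sub_nonneg.2 hx.2) (mul_nonneg (mul_self_nonneg _) (hk x ⟨hx.1, hxb⟩))
  have hcard : p ≤ S.card := by
    by_contra! hlt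
    have h0 := horth (Lagrange.nodal S id) (by rw [Lagrange.degree_nodal]; exact_mod_cast hlt)
    rcases hh with hh | hh
    · exact (key h hh0 hh).ne' h0
    · have := key (-h) (neg_ne_zero.2 hh0) hh
      rw [mul_neg, neg_mul, mul_neg, map_neg, h0, neg_zero] at this
      exact this.false
  have hdeg := (natDegree_lt_iff_degree_lt hf0).2 hfdeg
  rw [natDegree_mul hN0 hh0, Lagrange.natDegree_nodal] at hdeg
  refine ⟨S, by lia, hS, fun q hq => ?_⟩
  obtain ⟨c, rfl⟩ := natDegree_eq_zero.1 (show h.natDegree = 0 by lia)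
  have hc : c ≠ 0 := by simpa using hh0
  have h0 := horth q hq
  have : (C b - X) * (Lagrange.nodal S id * C c * q) =
      c • ((C b - X) * (Lagrange.nodal S id * q)) := by
    rw [smul_eq_C_mul]
    ring
  rw [this, map_smul, smul_eq_mul] at h0
  exact (mul_eq_zero.1 h0).resolve_left hc

/-- The interpolatory rule whose nodal polynomial satisfies an orthogonality relation. -/
theorem sum_polyIntegral_basis_mul_eval {a b : ℝ} {T : Finset ℝ} {n : ℕ}
    (horth : ∀ q : ℝ[X], q.degree < n → polyIntegral a b (Lagrange.nodal T id * q) = 0)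
    {q : ℝ[X]} (hq : q.degree < (T.card + n : ℕ)) :
    ∑ x ∈ T, polyIntegral a b (Lagrange.basis T id x) * q.eval x = polyIntegral a b q := by
  have hmonic : (Lagrange.nodal T (id : ℝ → ℝ)).Monic := Lagrange.nodal_monic
  set N := Lagrange.nodal T (id : ℝ → ℝ) with hN
  have hdiv : (q /ₘ N).degree < n := by
    by_cases hlt : q.degree < N.degree
    · rw [(divByMonic_eq_zero_iff hmonic).2 hlt, degree_zero]
      exact WithBot.bot_lt_coe n
    · have h := degree_add_divByMonic hmonic (not_lt.1 hlt)
      rw [← h, Lagrange.degree_nodal, Nat.cast_add] at hq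
      exact lt_of_add_lt_add_left hq
  have hmod : (q %ₘ N).degree < T.card := by
    simpa [hN, Lagrange.degree_nodal] using degree_modByMonic_lt q hmonic
  have heval : ∀ x ∈ T, (q %ₘ N).eval x = q.eval x := by
    intro x hx
    conv_rhs => rw [← modByMonic_add_div q N]
    have : N.eval x = 0 := Lagrange.eval_nodal_at_node (v := id) hx
    simp [this]
  have hr := Lagrange.eq_interpolate (f := q %ₘ N) (Set.injOn_id (T : Set ℝ)) hmod
  conv_rhs => rw [← modByMonic_add_div q N, map_add, horth _ hdiv, add_zero, hr,
    Lagrange.interpolate_apply, map_sum]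
  refine Finset.sum_congr rfl fun x hx => ?_
  rw [← smul_eq_C_mul, map_smul, smul_eq_mul, id, heval x hx, mul_comm]

/-- The right Gauß–Radau rule on `[a, b]`, indexed by its set of nodes. -/
theorem exists_radau_rule {a b : ℝ} (hab : a < b) (p : ℕ) :
    ∃ (T : Finset ℝ) (w : ℝ → ℝ), T.card = p + 1 ∧ b ∈ T ∧ (∀ x ∈ T, x ∈ Set.Ioc a b) ∧
      (∀ x ∈ T, 0 < w x) ∧
      ∀ q : ℝ[X], q.natDegree ≤ 2 * p → ∑ x ∈ T, w x * q.eval x = ∫ x in a..b, q.eval x := by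
  obtain ⟨S, hcard, hS, horth⟩ := exists_radau_nodes hab p
  have hbS : b ∉ S := fun h => (hS b h).2.false
  have hT : (insert b S).card = p + 1 := by rw [Finset.card_insert_of_notMem hbS, hcard]
  have horthT : ∀ q : ℝ[X], q.degree < p →
      polyIntegral a b (Lagrange.nodal (insert b S) id * q) = 0 := by
    intro q hq
    rw [Lagrange.nodal_insert_eq_nodal hbS, id, ← neg_sub, neg_mul, neg_mul, map_neg, mul_assoc,
      horth q hq, neg_zero]
  have hexact : ∀ q : ℝ[X], q.natDegree ≤ 2 * p →
      ∑ x ∈ insert b S, polyIntegral a b (Lagrange.basis (insert b S) id x) * q.eval x =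
        polyIntegral a b q := by
    intro q hq
    refine sum_polyIntegral_basis_mul_eval horthT (degree_le_natDegree.trans_lt ?_)
    rw [hT]
    exact_mod_cast (by lia : q.natDegree < p + 1 + p)
  refine ⟨insert b S, fun x => polyIntegral a b (Lagrange.basis (insert b S) id x), hT,
    Finset.mem_insert_self b S, ?_, ?_, hexact⟩
  · intro x hx
    rcases Finset.mem_insert.1 hx with rfl | hx
    · exact ⟨hab, le_rfl⟩
    · exact Set.Ioo_subset_Ioc_self (hS x hx)
  have pos_of_test : ∀ x ∈ insert b S, ∀ q : ℝ[X], q ≠ 0 → q.natDegree ≤ 2 * p →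
      (∀ y, y ≤ b → 0 ≤ q.eval y) → (∀ y ∈ insert b S, y ≠ x → q.eval y = 0) → x ≤ b →
      0 < polyIntegral a b (Lagrange.basis (insert b S) id x) := by
    intro x hx q hq0 hq hnn hvanish hxb
    have hpos := polyIntegral_pos hab hq0 fun y hy => hnn y hy.2
    rw [← hexact q hq, Finset.sum_eq_single_of_mem x hx
      fun y hy hyx => by rw [hvanish y hy hyx, mul_zero]] at hpos
    exact pos_of_mul_pos_left hpos (hnn x hxb)
  intro x hx
  rcases Finset.mem_insert.1 hx with rfl | hxS
  · refine pos_of_test x hx (Lagrange.nodal S id ^ 2) (pow_ne_zero 2 Lagrange.nodal_ne_zero) ?_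
      ?_ ?_ le_rfl
    · rw [natDegree_pow, Lagrange.natDegree_nodal, hcard]
    · intro y _
      rw [eval_pow]
      exact sq_nonneg _
    · intro y hy hyx
      have : (Lagrange.nodal S (id : ℝ → ℝ)).eval y = 0 :=
        Lagrange.eval_nodal_at_node (v := id) (Finset.mem_of_mem_insert_of_ne hy hyx)
      simp [this]
  · have hX : (C b - X : ℝ[X]) ≠ 0 := by
      rw [← neg_sub]
      exact neg_ne_zero.2 (X_sub_C_ne_zero b)
    refine pos_of_test x hx ((C b - X) * Lagrange.nodal (S.erase x) id ^ 2)
      (mul_ne_zero hX (pow_ne_zero 2 Lagrange.nodal_ne_zero)) ?_ ?_ ?_ (hS x hxS).2.le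
    · have hXdeg : (C b - X : ℝ[X]).natDegree = 1 := by
        rw [← neg_sub, natDegree_neg, natDegree_X_sub_C]
      have hc := Finset.card_erase_add_one hxS
      rw [natDegree_mul hX (pow_ne_zero 2 Lagrange.nodal_ne_zero), natDegree_pow,
        Lagrange.natDegree_nodal, hXdeg]
      lia
    · intro y hy
      simpa using mul_nonneg (sub_nonneg.2 hy) (sq_nonneg _)
    · intro y hy hyx
      rcases Finset.mem_insert.1 hy with rfl | hyS
      · simp
      · have : (Lagrange.nodal (S.erase x) (id : ℝ → ℝ)).eval y = 0 :=
          Lagrange.eval_nodal_at_node (v := id) (Finset.mem_erase.2 ⟨hyx, hyS⟩)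
        simp [this]

/-- Existence of the right Gauß–Radau quadrature rule with `p+1` points:
nodes `-1 < t 0 < ⋯ < t p = 1` and positive weights `ω i` such that
`∑ i, ω i * q (t i) = ∫ x in -1..1, q x` for every polynomial `q` of degree at most `2p`. -/
theorem gauss_radau_exists (p : ℕ) :
    ∃ (t ω : Fin (p + 1) → ℝ),
      StrictMono t ∧
      (-1 : ℝ) < t 0 ∧
      t (Fin.last p) = 1 ∧
      (∀ i, 0 < ω i) ∧
      (∀ q : Polynomial ℝ, q.natDegree ≤ 2 * p →
        ∑ i, ω i * q.eval (t i) = ∫ x in (-1:ℝ)..1, q.eval x) := by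
  obtain ⟨T, w, hcard, h1, hT, hw, hexact⟩ :=
    exists_radau_rule (show (-1 : ℝ) < 1 by norm_num) p
  have hmem := T.orderEmbOfFin_mem hcard
  refine ⟨T.orderEmbOfFin hcard, fun i => w (T.orderEmbOfFin hcard i),
    (T.orderEmbOfFin hcard).strictMono, (hT _ (hmem 0)).1, ?_, fun i => hw _ (hmem i), ?_⟩
  · refine le_antisymm (hT _ (hmem _)).2 ?_
    obtain ⟨i, hi⟩ : (1 : ℝ) ∈ Set.range (T.orderEmbOfFin hcard) := by
      rw [Finset.range_orderEmbOfFin]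
      exact h1
    rw [← hi]
    exact (T.orderEmbOfFin hcard).monotone (Fin.le_last i)
  · intro q hq
    rw [← hexact q hq]
    conv_rhs => rw [← Finset.map_orderEmbOfFin_univ T hcard]
    rw [Finset.sum_map]
    rfl
end

section
/- (Superconvergence of DG at the endpoint.) Let f : ℝ × ℝ → ℝ be of class C^{2p+1} and globally Lipschitz in its second argument, let u solve u′(t) = f(t, u(t)), and fix t_n. Then there exist C > 0 and h_0 > 0 such that for every 0 < h ≤ h_0 and every polynomial u_h of degree at most p on I_n = [t_n, t_n + h] satisfying the DG weak formulation −∫_{I_n} u_h v′ dt + u_h(t_n + h) v(t_n + h) − u(t_n) v(t_n) = ∫_{I_n} f(t, u_h(t)) v(t) dt for all polynomials v of degree at most p, one has |u(t_n + h) − u_h(t_n + h)| ≤ C h^{2p+2}. -/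
open Polynomial Set

theorem integral_mul_polynomial_eq_zero {r : ℝ → ℝ} (hr : Continuous r) {a b : ℝ} {p : ℕ}
    (h : ∀ j < p, ∫ x in a..b, r x * x ^ j = 0) {s : ℝ[X]} (hs : s.degree < p) :
    ∫ x in a..b, r x * s.eval x = 0 := by
  have h1 : ∀ x, r x * s.eval x = ∑ j ∈ Finset.range p, s.coeff j * (r x * x ^ j) := by
    intro x
    rcases eq_or_ne s 0 with rfl | hs0
    · simp
    · rw [eval_eq_sum_range' ((natDegree_lt_iff_degree_lt hs0).2 hs),
        Finset.mul_sum]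
      exact Finset.sum_congr rfl fun j _ => by ring
  simp_rw [h1]
  rw [intervalIntegral.integral_finsetSum
    fun j _ => (by fun_prop : Continuous _).intervalIntegrable _ _]
  refine Finset.sum_eq_zero fun j hj => ?_
  rw [intervalIntegral.integral_const_mul, h j (Finset.mem_range.1 hj), mul_zero]

/-- A polynomial is determined by its Radau data on `[0, 1]`. -/
theorem polynomial_eq_zero_of_radau {p : ℕ} {q : ℝ[X]} (hq : q.degree < (p + 1 : ℕ))
    (h1 : q.eval 1 = 0) (h : ∀ j < p, ∫ x in (0 : ℝ)..1, q.eval x * x ^ j = 0) : q = 0 := by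
  obtain ⟨g, rfl⟩ := Polynomial.dvd_iff_isRoot.2 (show q.IsRoot 1 from h1)
  by_contra hne
  have hg : g ≠ 0 := right_ne_zero_of_mul hne
  have hgp : g.degree < p := by
    rw [Polynomial.degree_mul, Polynomial.degree_X_sub_C, Polynomial.degree_eq_natDegree hg] at hq
    rw [Polynomial.degree_eq_natDegree hg]
    norm_cast at hq ⊢
    omega
  have h0 := integral_mul_polynomial_eq_zero (by fun_prop) h hgp
  have hpos : 0 < ∫ x in (0 : ℝ)..1, (1 - x) * g.eval x ^ 2 := by
    refine intervalIntegral.integral_pos one_pos (by fun_prop)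
      (fun x hx => mul_nonneg (by linarith [hx.2]) (sq_nonneg _)) ?_
    obtain ⟨c, hc, hgc⟩ := ((Ioo_infinite (zero_lt_one' ℝ)).sdiff
      (g.roots.toFinset.finite_toSet)).nonempty
    refine ⟨c, Ioo_subset_Icc_self hc, mul_pos (by linarith [hc.2]) ?_⟩
    have : g.eval c ≠ 0 := by simpa [hg] using hgc
    positivity
  have h2 : ∫ x in (0 : ℝ)..1, (1 - x) * g.eval x ^ 2
      = -∫ x in (0 : ℝ)..1, ((X - C 1) * g).eval x * g.eval x := by
    rw [← intervalIntegral.integral_neg]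
    refine intervalIntegral.integral_congr fun x _ => ?_
    simp only [eval_mul, eval_sub, eval_X, eval_C]
    ring
  rw [h2, h0] at hpos
  simp at hpos

/-- Uniform stability of the Radau projection on `[0, 1]`. -/
theorem exists_radau_bound_unit (p : ℕ) : ∃ K : ℝ, 0 ≤ K ∧ ∀ (q : ℝ[X]) (ω : ℝ → ℝ) (M : ℝ),
    q.natDegree ≤ p → Continuous ω → (∀ x ∈ Icc (0 : ℝ) 1, |ω x| ≤ M) → q.eval 1 = ω 1 →
    (∀ j < p, ∫ x in (0 : ℝ)..1, (q.eval x - ω x) * x ^ j = 0) →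
    ∀ x ∈ Icc (0 : ℝ) 1, |q.eval x| ≤ K * M := by
  let D : ℝ[X] →ₗ[ℝ] (Fin (p + 1) → ℝ) :=
    { toFun := fun q i => if (i : ℕ) = p then q.eval 1 else ∫ x in (0 : ℝ)..1, q.eval x * x ^ (i : ℕ)
      map_add' := fun q r => by
        ext i
        simp only [Pi.add_apply]
        split_ifs
        · simp
        · simp only [eval_add, add_mul]
          exact intervalIntegral.integral_add
            ((by fun_prop : Continuous _).intervalIntegrable _ _)
            ((by fun_prop : Continuous _).intervalIntegrable _ _)
      map_smul' := fun c q => by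
        ext i
        simp only [Pi.smul_apply, RingHom.id_apply, smul_eq_mul]
        split_ifs
        · simp
        · simp only [eval_smul, smul_eq_mul, mul_assoc]
          exact intervalIntegral.integral_const_mul _ _ }
  let e := degreeLTEquiv ℝ (p + 1)
  let L : (Fin (p + 1) → ℝ) →ₗ[ℝ] (Fin (p + 1) → ℝ) :=
    D ∘ₗ (degreeLT ℝ (p + 1)).subtype ∘ₗ e.symm.toLinearMap
  have hL : L.ker = ⊥ := by
    rw [LinearMap.ker_eq_bot']
    intro c hc
    have hz : ((e.symm c : degreeLT ℝ (p + 1)) : ℝ[X]) = 0 := by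
      refine polynomial_eq_zero_of_radau (p := p) (mem_degreeLT.1 (e.symm c).2) ?_ fun j hj => ?_
      · simpa [L, D] using congrFun hc (Fin.last p)
      · simpa [L, D, hj.ne] using congrFun hc ⟨j, by omega⟩
    simpa using hz
  obtain ⟨G, hG⟩ := L.exists_leftInverse_of_injective hL
  refine ⟨(p + 1) * ‖G.toContinuousLinearMap‖, by positivity, ?_⟩
  intro q ω M hq hω hM h1 horth x hx
  have hM0 : 0 ≤ M := (abs_nonneg _).trans (hM 1 (by simp))
  have hqm : q ∈ degreeLT ℝ (p + 1) := by
    rw [mem_degreeLT]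
    exact (degree_le_of_natDegree_le hq).trans_lt (by exact_mod_cast Nat.lt_succ_self p)
  set c := e ⟨q, hqm⟩ with hc
  have hLc : L c = D q := by simp [L, hc]
  have hD : ‖D q‖ ≤ M := by
    refine (pi_norm_le_iff_of_nonneg hM0).2 fun i => ?_
    simp only [D, LinearMap.coe_mk, AddHom.coe_mk]
    split_ifs with hi
    · rw [h1]; exact hM 1 (by simp)
    · have hi' : (i : ℕ) < p := by omega
      have h2 := horth i hi'
      simp only [sub_mul] at h2
      rw [intervalIntegral.integral_sub ((by fun_prop : Continuous _).intervalIntegrable _ _)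
        ((by fun_prop : Continuous _).intervalIntegrable _ _), sub_eq_zero] at h2
      rw [h2]
      refine (intervalIntegral.norm_integral_le_of_norm_le_const (C := M) fun y hy => ?_).trans
        (by simp)
      rw [uIoc_of_le zero_le_one] at hy
      rw [norm_mul, norm_pow, Real.norm_eq_abs, Real.norm_eq_abs, abs_of_pos hy.1]
      exact mul_le_of_le_one_right (abs_nonneg _) (pow_le_one₀ hy.1.le hy.2)
        |>.trans (hM y ⟨hy.1.le, hy.2⟩)
  have hcn : ‖c‖ ≤ ‖G.toContinuousLinearMap‖ * M := by
    have : c = G.toContinuousLinearMap (D q) := by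
      rw [← hLc]
      exact (LinearMap.congr_fun hG c).symm
    rw [this]
    exact (ContinuousLinearMap.le_opNorm _ _).trans (by gcongr)
  rw [eval_eq_sum_range' (Nat.lt_succ_of_le hq), mul_assoc]
  refine (Finset.abs_sum_le_sum_abs _ _).trans ?_
  refine (Finset.sum_le_card_nsmul _ _ (‖G.toContinuousLinearMap‖ * M) fun j hj => ?_).trans
    (by simp)
  rw [abs_mul, abs_pow, abs_of_nonneg hx.1]
  refine (mul_le_of_le_one_right (abs_nonneg _) (pow_le_one₀ hx.1 hx.2)).trans ?_
  have : q.coeff j = c ⟨j, Finset.mem_range.1 hj⟩ := rfl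
  rw [this]
  exact (norm_le_pi_norm c _).trans hcn

theorem exists_polynomial_approx {g : ℝ → ℝ} {n : ℕ} (hg : ContDiff ℝ (n + 1) g) (a : ℝ) :
    ∃ C : ℝ, 0 ≤ C ∧ ∃ P : ℝ[X], P.natDegree ≤ n ∧
      ∀ x ∈ Icc a (a + 1), |g x - P.eval x| ≤ C * (x - a) ^ (n + 1) := by
  obtain ⟨c, hc⟩ := exists_taylor_mean_remainder_bound (n := n) (by linarith : a ≤ a + 1)
    hg.contDiffOn
  refine ⟨|c|, abs_nonneg _, ∑ k ∈ Finset.range (n + 1),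
    C ((k.factorial : ℝ)⁻¹ * iteratedDerivWithin k g (Icc a (a + 1)) a) * (X - C a) ^ k, ?_, ?_⟩
  · refine natDegree_sum_le_of_forall_le _ _ fun k hk => ?_
    refine (natDegree_C_mul_le _ _).trans ?_
    rw [natDegree_pow, natDegree_X_sub_C]
    have := Finset.mem_range.1 hk
    omega
  · intro x hx
    have h := hc x hx
    rw [taylor_within_apply, Real.norm_eq_abs] at h
    have h2 : 0 ≤ (x - a) ^ (n + 1) := pow_nonneg (by linarith [hx.1]) _
    refine (le_of_eq ?_).trans (h.trans (mul_le_mul_of_nonneg_right (le_abs_self c) h2))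
    congr 2
    rw [eval_finsetSum]
    refine Finset.sum_congr rfl fun k _ => ?_
    simp
    ring

theorem contDiff_of_hasDerivAt_comp {f : ℝ → ℝ → ℝ} {u : ℝ → ℝ}
    (hu : ∀ t, HasDerivAt u (f t (u t)) t) {n : ℕ} (hf : ContDiff ℝ n (Function.uncurry f)) :
    ContDiff ℝ (n + 1) u := by
  have hd : deriv u = fun t => Function.uncurry f (t, u t) := funext fun t => (hu t).deriv
  have step : ∀ m : ℕ, ContDiff ℝ m (Function.uncurry f) → ContDiff ℝ m u →
      ContDiff ℝ (m + 1) u := fun m hfm hum => by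
    rw [contDiff_succ_iff_deriv]
    refine ⟨fun t => (hu t).differentiableAt, by simp, ?_⟩
    rw [hd]
    exact hfm.comp (contDiff_id.prodMk hum)
  induction n with
  | zero =>
    exact step 0 hf (contDiff_zero.2 (continuous_iff_continuousAt.2 fun t => (hu t).continuousAt))
  | succ n ih => exact step _ hf (by exact_mod_cast ih (hf.of_le (by exact_mod_cast n.le_succ)))

theorem exists_linearization_bound {f : ℝ → ℝ → ℝ} (hf : ContDiff ℝ 2 (Function.uncurry f))
    {u : ℝ → ℝ} (hu : Continuous u) (a : ℝ) :
    ∃ L : ℝ, 0 ≤ L ∧ ∀ t ∈ Icc a (a + 1), ∀ y, |y - u t| ≤ 1 →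
      |f t y - f t (u t) - fderiv ℝ (Function.uncurry f) (t, u t) (0, 1) * (y - u t)|
        ≤ L * (y - u t) ^ 2 := by
  obtain ⟨M, hM⟩ := isCompact_Icc.exists_bound_of_continuousOn (hu.continuousOn (s := Icc a (a + 1)))
  set D : ℝ × ℝ → ℝ := fun z => fderiv ℝ (Function.uncurry f) z (0, 1)
  have hD : ContDiff ℝ 1 D :=
    (hf.fderiv_right (m := 1) (by norm_num)).clm_apply contDiff_const
  obtain ⟨K, hK⟩ := hD.locallyLipschitz.locallyLipschitzOn.exists_lipschitzOnWith_of_compact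
    (isCompact_Icc.prod isCompact_Icc : IsCompact (Icc a (a + 1) ×ˢ Icc (-(M + 1)) (M + 1)))
  refine ⟨K, K.2, fun t ht y hy => ?_⟩
  have hut := abs_le.1 (hM t ht)
  have hd : ∀ z, HasDerivAt (f t) (D (t, z)) z := fun z => by
    have h1 : HasFDerivAt (Function.uncurry f) (fderiv ℝ (Function.uncurry f) (t, z)) (t, z) :=
      (hf.differentiable (by norm_num) _).hasFDerivAt
    exact h1.comp_hasDerivAt z ((hasDerivAt_const z t).prodMk (hasDerivAt_id z))
  have hmem : ∀ z, |z - u t| ≤ 1 → (t, z) ∈ Icc a (a + 1) ×ˢ Icc (-(M + 1)) (M + 1) := fun z hz => by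
    have := abs_le.1 hz
    exact ⟨ht, by constructor <;> simp only <;> linarith⟩
  have hsub : ∀ z ∈ uIcc (u t) y, |z - u t| ≤ |y - u t| := fun z hz => abs_sub_left_of_mem_uIcc hz
  have := Convex.norm_image_sub_le_of_norm_hasDerivWithin_le
    (f := fun z => f t z - D (t, u t) * z) (f' := fun z => D (t, z) - D (t, u t))
    (s := uIcc (u t) y) (x := u t) (y := y) (C := K * |y - u t|)
    (fun z _ => by
      simpa using ((hd z).fun_sub ((hasDerivAt_id z).const_mul (D (t, u t)))).hasDerivWithinAt)
    (fun z hz => by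
      have h1 := hK.dist_le_mul _ (hmem z ((hsub z hz).trans hy)) _ (hmem (u t) (by simp))
      rw [Real.dist_eq] at h1
      refine h1.trans ?_
      rw [Prod.dist_eq, dist_self, Real.dist_eq, max_eq_right (abs_nonneg _)]
      exact mul_le_mul_of_nonneg_left (hsub z hz) K.2)
    (convex_uIcc _ _) left_mem_uIcc right_mem_uIcc
  simp only [Real.norm_eq_abs, mul_assoc, abs_mul_abs_self] at this
  rw [pow_two]
  refine (le_of_eq ?_).trans this
  congr 1
  ring

/-- Uniform stability of the Radau projection on intervals of arbitrary length. -/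
theorem exists_radau_bound (p : ℕ) : ∃ K : ℝ, 0 ≤ K ∧
    ∀ (q : ℝ[X]) (ω : ℝ → ℝ) (a h M : ℝ), 0 < h → q.natDegree ≤ p → Continuous ω →
    (∀ x ∈ Icc a (a + h), |ω x| ≤ M) → q.eval (a + h) = ω (a + h) →
    (∀ s : ℝ[X], s.degree < p → ∫ x in a..(a + h), (q.eval x - ω x) * s.eval x = 0) →
    ∀ x ∈ Icc a (a + h), |q.eval x| ≤ K * M := by
  obtain ⟨K, hK0, hK⟩ := exists_radau_bound_unit p
  refine ⟨K, hK0, fun q ω a h M hh hq hω hM h1 horth x hx => ?_⟩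
  have hev : ∀ y, (q.comp (C a + C h * X)).eval y = q.eval (a + h * y) := fun y => by simp
  have key := hK (q.comp (C a + C h * X)) (fun y => ω (a + h * y)) M ?_ (by fun_prop) ?_ ?_ ?_
    ((x - a) / h) ⟨div_nonneg (by linarith [hx.1]) hh.le, (div_le_one hh).2 (by linarith [hx.2])⟩
  · rwa [hev, mul_div_cancel₀ _ hh.ne', add_sub_cancel] at key
  · refine natDegree_comp_le.trans ?_
    have : (C a + C h * X : ℝ[X]).natDegree ≤ 1 := by
      rw [add_comm]; exact natDegree_linear_le
    nlinarith
  · intro y hy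
    exact hM _ ⟨by nlinarith [hy.1], by nlinarith [hy.2]⟩
  · rw [hev, mul_one, h1]
  · intro j hj
    have hs := horth ((C h⁻¹ * (X - C a)) ^ j) <| by
      refine (degree_pow_le _ _).trans_lt ?_
      rw [degree_C_mul (inv_ne_zero hh.ne'), degree_X_sub_C]
      simpa using hj
    have := intervalIntegral.integral_comp_add_mul (a := 0) (b := 1)
      (fun y => (q.eval y - ω y) * ((C h⁻¹ * (X - C a)) ^ j).eval y) hh.ne' a
    rw [mul_zero, add_zero, mul_one, hs, smul_zero] at this
    refine (intervalIntegral.integral_congr fun y _ => ?_).trans this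
    simp only [hev, eval_pow, eval_mul, eval_C, eval_sub, eval_X, add_sub_cancel_left,
      inv_mul_cancel_left₀ hh.ne']

/-- The DG solution is the Radau projection of the primitive of its right-hand side. -/
theorem radau_of_weak_formulation {p : ℕ} {F : ℝ → ℝ} (hF : Continuous F) {a b c : ℝ} {q : ℝ[X]}
    (hw : ∀ v : ℝ[X], v.natDegree ≤ p →
      -(∫ x in a..b, q.eval x * (derivative v).eval x) + q.eval b * v.eval b - c * v.eval a
        = ∫ x in a..b, F x * v.eval x) :
    q.eval b = c + ∫ x in a..b, F x ∧ ∀ s : ℝ[X], s.degree < p →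
      ∫ x in a..b, (q.eval x - (c + ∫ y in a..x, F y)) * s.eval x = 0 := by
  have hb : q.eval b = c + ∫ x in a..b, F x := by
    have := hw 1 (by simp)
    simp at this
    linarith
  set w : ℝ → ℝ := fun t => c + ∫ y in a..t, F y with hwdef
  have hwd : ∀ t, HasDerivAt w (F t) t := fun t =>
    (hF.integral_hasStrictDerivAt a t).hasDerivAt.const_add c
  have hwc : Continuous w := continuous_iff_continuousAt.2 fun t => (hwd t).continuousAt
  refine ⟨hb, fun s hs => integral_mul_polynomial_eq_zero (r := fun x => q.eval x - w x)
    (by fun_prop) (fun j hj => ?_) hs⟩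
  have hv := hw (X ^ (j + 1)) (by rw [natDegree_X_pow]; omega)
  have hparts := intervalIntegral.integral_mul_deriv_eq_deriv_mul (a := a) (b := b)
    (fun x _ => hwd x) (fun x _ => (X ^ (j + 1) : ℝ[X]).hasDerivAt x)
    (hF.intervalIntegrable _ _) ((derivative (X ^ (j + 1) : ℝ[X])).continuous.intervalIntegrable _ _)
  have hwa : w a = c := by simp [hwdef]
  rw [hwa] at hparts
  have hwb : w b = q.eval b := hb.symm
  rw [hwb] at hparts
  have h0 : ∫ x in a..b, (q.eval x - w x) * (derivative (X ^ (j + 1) : ℝ[X])).eval x = 0 := by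
    simp only [sub_mul]
    rw [intervalIntegral.integral_sub ((by fun_prop : Continuous _).intervalIntegrable _ _)
      ((by fun_prop : Continuous _).intervalIntegrable _ _)]
    linarith
  have h1 : ∀ x, (q.eval x - w x) * (derivative (X ^ (j + 1) : ℝ[X])).eval x
      = ((j : ℝ) + 1) * ((q.eval x - w x) * x ^ j) := fun x => by
    simp
    ring
  simp_rw [h1] at h0
  rw [intervalIntegral.integral_const_mul] at h0
  exact (mul_eq_zero.1 h0).resolve_left (by positivity)

theorem abs_sub_primitive_le {f : ℝ → ℝ → ℝ} {Λ : NNReal} (hf : Continuous (Function.uncurry f))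
    (hLip : ∀ t, LipschitzWith Λ (f t)) {u V : ℝ → ℝ} (hu : ∀ t, HasDerivAt u (f t (u t)) t)
    (hV : Continuous V) {a h E : ℝ} (hE : ∀ x ∈ Icc a (a + h), |u x - V x| ≤ E) :
    ∀ t ∈ Icc a (a + h), |u t - (u a + ∫ x in a..t, f x (V x))| ≤ Λ * E * h := by
  intro t ht
  have huc : Continuous u := continuous_iff_continuousAt.2 fun t => (hu t).continuousAt
  have hc : ∀ y : ℝ → ℝ, Continuous y → Continuous fun x => f x (y x) := fun y hy =>
    hf.comp (continuous_id.prodMk hy)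
  have h1 := intervalIntegral.integral_eq_sub_of_hasDerivAt (a := a) (b := t) (fun x _ => hu x)
    ((hc u huc).intervalIntegrable _ _)
  have h2 : u t - (u a + ∫ x in a..t, f x (V x)) = ∫ x in a..t, (f x (u x) - f x (V x)) := by
    rw [intervalIntegral.integral_sub ((hc u huc).intervalIntegrable _ _)
      ((hc V hV).intervalIntegrable _ _), h1]
    ring
  have hE0 : 0 ≤ E := (abs_nonneg _).trans (hE t ht)
  rw [h2, ← Real.norm_eq_abs]
  refine (intervalIntegral.norm_integral_le_of_norm_le_const (C := Λ * E) fun x hx => ?_).trans ?_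
  · rw [uIoc_of_le ht.1] at hx
    have := (hLip x).dist_le_mul (u x) (V x)
    rw [Real.dist_eq, Real.dist_eq] at this
    exact this.trans (mul_le_mul_of_nonneg_left (hE x ⟨hx.1.le, hx.2.trans ht.2⟩) Λ.2)
  · rw [abs_of_nonneg (by linarith [ht.1])]
    exact mul_le_mul_of_nonneg_left (by linarith [ht.2]) (mul_nonneg Λ.2 hE0)

/-- Convergence of optimal order, uniformly on the interval. -/
theorem exists_dg_error_bound {p : ℕ} {f : ℝ → ℝ → ℝ} {Λ : NNReal}
    (hf : ContDiff ℝ p (Function.uncurry f)) (hLip : ∀ t, LipschitzWith Λ (f t))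
    {u : ℝ → ℝ} (hu : ∀ t, HasDerivAt u (f t (u t)) t) (a : ℝ) :
    ∃ C : ℝ, 0 ≤ C ∧ ∃ h₀ : ℝ, 0 < h₀ ∧ h₀ ≤ 1 ∧ ∀ h : ℝ, 0 < h → h ≤ h₀ →
      ∀ q : ℝ[X], q.natDegree ≤ p →
        q.eval (a + h) = u a + ∫ x in a..(a + h), f x (q.eval x) →
        (∀ s : ℝ[X], s.degree < p →
          ∫ x in a..(a + h), (q.eval x - (u a + ∫ y in a..x, f y (q.eval y))) * s.eval x = 0) →
        ∀ x ∈ Icc a (a + h), |u x - q.eval x| ≤ C * h ^ (p + 1) := by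
  obtain ⟨K, hK0, hK⟩ := exists_radau_bound p
  obtain ⟨c, hc0, P, hP, hPu⟩ := exists_polynomial_approx (contDiff_of_hasDerivAt_comp hu hf) a
  have hden : 0 < 2 * (K * Λ + 1) := by positivity
  refine ⟨2 * (K + 1) * c, by positivity, min 1 (1 / (2 * (K * Λ + 1))), by positivity,
    min_le_left _ _, fun h hh hh0 q hq hend horth => ?_⟩
  have hh1 : h ≤ 1 := hh0.trans (min_le_left _ _)
  have hKh : h * (2 * (K * Λ + 1)) ≤ 1 := (le_div_iff₀ hden).1 (hh0.trans (min_le_right _ _))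
  have huc : Continuous u := continuous_iff_continuousAt.2 fun t => (hu t).continuousAt
  obtain ⟨z, hz, hzmax⟩ := isCompact_Icc.exists_isMaxOn (nonempty_Icc.2 (by linarith : a ≤ a + h))
    (by fun_prop : ContinuousOn (fun x => |u x - q.eval x|) (Icc a (a + h)))
  set E := |u z - q.eval z| with hEdef
  have hE : ∀ x ∈ Icc a (a + h), |u x - q.eval x| ≤ E := fun x hx => hzmax hx
  have hcF : Continuous fun x => f x (q.eval x) :=
    hf.continuous.comp (continuous_id.prodMk q.continuous)
  have hw := abs_sub_primitive_le hf.continuous hLip hu q.continuous hE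
  have hP' : ∀ x ∈ Icc a (a + h), |u x - P.eval x| ≤ c * h ^ (p + 1) := fun x hx =>
    (hPu x ⟨hx.1, by linarith [hx.2]⟩).trans <| by
      have : 0 ≤ x - a := by linarith [hx.1]
      have : x - a ≤ h := by linarith [hx.2]
      gcongr
  have hstab := hK (q - P) (fun t => (u a + ∫ x in a..t, f x (q.eval x)) - P.eval t) a h
    (Λ * E * h + c * h ^ (p + 1)) hh ((natDegree_sub_le _ _).trans (max_le hq hP))
    ((continuous_const.add (intervalIntegral.continuous_primitive
      (fun x y => hcF.intervalIntegrable x y) a)).sub P.continuous)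
    (fun x hx => by
      have h1 := abs_le.1 (hw x hx)
      have h2 := abs_le.1 (hP' x hx)
      exact abs_le.2 ⟨by linarith, by linarith⟩)
    (by rw [eval_sub, hend])
    (fun s hs => by simpa using horth s hs)
  have h3 := abs_le.1 (hstab z hz)
  have h4 := abs_le.1 (hP' z hz)
  rw [eval_sub] at h3
  have hEle : E ≤ K * (Λ * E * h + c * h ^ (p + 1)) + c * h ^ (p + 1) :=
    abs_le.2 ⟨by linarith, by linarith⟩
  have hE0 : 0 ≤ E := abs_nonneg _
  intro x hx
  refine (hE x hx).trans ?_
  nlinarith [mul_le_mul_of_nonneg_left hKh hE0, mul_nonneg hE0 hh.le]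

/-- Variation of constants for the defect of an approximate solution of a linear equation. -/
theorem mul_exp_neg_primitive_eq_integral {A e e' : ℝ → ℝ} (hA : Continuous A)
    (he : ∀ t, HasDerivAt e (e' t) t) (he' : Continuous e') {a b : ℝ} (hea : e a = 0) :
    e b * Real.exp (-∫ x in a..b, A x)
      = ∫ t in a..b, Real.exp (-∫ x in a..t, A x) * (e' t - A t * e t) := by
  have hB : ∀ t, HasDerivAt (fun t => ∫ x in a..t, A x) (A t) t := fun t =>
    (hA.integral_hasStrictDerivAt a t).hasDerivAt
  have hBc : Continuous fun t => ∫ x in a..t, A x :=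
    continuous_iff_continuousAt.2 fun t => (hB t).continuousAt
  have hec : Continuous e := continuous_iff_continuousAt.2 fun t => (he t).continuousAt
  have hd : ∀ t, HasDerivAt (fun t => e t * Real.exp (-∫ x in a..t, A x))
      (Real.exp (-∫ x in a..t, A x) * (e' t - A t * e t)) t := fun t =>
    ((he t).mul (hB t).fun_neg.exp).congr_deriv (by ring)
  rw [intervalIntegral.integral_eq_sub_of_hasDerivAt (fun t _ => hd t)
    ((by fun_prop : Continuous _).intervalIntegrable _ _), hea, zero_mul, sub_zero]

/-- Integrals against a smooth weight of functions orthogonal to low-degree polynomials. -/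
theorem exists_integral_orthogonal_bound {g : ℝ → ℝ} {n : ℕ} (hg : ContDiff ℝ (n + 1) g) (a : ℝ) :
    ∃ C : ℝ, 0 ≤ C ∧ ∀ (h R : ℝ) (r : ℝ → ℝ), 0 < h → h ≤ 1 → Continuous r →
      (∀ x ∈ Icc a (a + h), |r x| ≤ R) →
      (∀ s : ℝ[X], s.degree < (n + 1 : ℕ) → ∫ x in a..(a + h), r x * s.eval x = 0) →
      |∫ x in a..(a + h), g x * r x| ≤ C * h ^ (n + 1) * R * h := by
  obtain ⟨c, hc0, P, hP, hPg⟩ := exists_polynomial_approx hg a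
  refine ⟨c, hc0, fun h R r hh hh1 hr hR horth => ?_⟩
  have hgc := hg.continuous
  have h1 : ∫ x in a..(a + h), g x * r x = ∫ x in a..(a + h), (g x - P.eval x) * r x := by
    have h2 := horth P ((degree_le_of_natDegree_le hP).trans_lt (by exact_mod_cast n.lt_succ_self))
    simp only [sub_mul]
    rw [intervalIntegral.integral_sub ((by fun_prop : Continuous _).intervalIntegrable _ _)
      ((by fun_prop : Continuous _).intervalIntegrable _ _)]
    simp only [mul_comm (eval _ P), h2, sub_zero]
  rw [h1, ← Real.norm_eq_abs]
  refine (intervalIntegral.norm_integral_le_of_norm_le_const (C := c * h ^ (n + 1) * R)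
    fun x hx => ?_).trans (by simp [abs_of_pos hh])
  rw [uIoc_of_le (by linarith)] at hx
  rw [norm_mul]
  have h3 : 0 ≤ x - a := by linarith [hx.1]
  have h4 : x - a ≤ h := by linarith [hx.2]
  refine mul_le_mul ((hPg x ⟨hx.1.le, by linarith⟩).trans (by gcongr))
    (hR x ⟨hx.1.le, hx.2⟩) (norm_nonneg _) (by positivity)

/-- Superconvergence of the DG method at the endpoint. If `f` is `C^{2p+1}`
and globally Lipschitz in its second argument, `u` solves `u' = f(t, u)`, then there are
`C > 0` and `h₀ > 0` such that for all `0 < h ≤ h₀`, every polynomial `u_h` of degree at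
most `p` satisfying the DG weak formulation on `[t_n, t_n + h]` with inflow `u(t_n)`
satisfies `|u(t_n + h) - u_h(t_n + h)| ≤ C h^{2p+2}`. -/
theorem dg_superconvergence_endpoint (p : ℕ) (f : ℝ → ℝ → ℝ) (Λ : NNReal)
    (hf : ContDiff ℝ (2 * p + 1) (Function.uncurry f))
    (hLip : ∀ t, LipschitzWith Λ (f t))
    (u : ℝ → ℝ) (hu : ∀ t, HasDerivAt u (f t (u t)) t)
    (tn : ℝ) :
    ∃ C > 0, ∃ h₀ > 0, ∀ h : ℝ, 0 < h → h ≤ h₀ →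
      ∀ uh : Polynomial ℝ, uh.natDegree ≤ p →
        (∀ v : Polynomial ℝ, v.natDegree ≤ p →
          -(∫ x in tn..(tn + h), uh.eval x * (Polynomial.derivative v).eval x)
              + uh.eval (tn + h) * v.eval (tn + h) - u tn * v.eval tn
            = ∫ x in tn..(tn + h), f x (uh.eval x) * v.eval x) →
        |u (tn + h) - uh.eval (tn + h)| ≤ C * h ^ (2 * p + 2) := by
  have hf' : ContDiff ℝ ((2 * p + 1 : ℕ) : WithTop ℕ∞) (Function.uncurry f) := by exact_mod_cast hf
  obtain ⟨c, hc0, h₀, hh₀, hh₀1, herr⟩ := exists_dg_error_bound (p := p)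
    (hf'.of_le (by exact_mod_cast (by omega : p ≤ 2 * p + 1))) hLip hu tn
  have hcF : ∀ q : ℝ[X], Continuous fun x => f x (q.eval x) := fun q =>
    hf.continuous.comp (continuous_id.prodMk q.continuous)
  rcases p with _ | n
  · refine ⟨Λ * c + 1, by positivity, h₀, hh₀, fun h hh hh0 q hq hw => ?_⟩
    obtain ⟨hend, horth⟩ := radau_of_weak_formulation (hcF q) hw
    have h1 := abs_sub_primitive_le hf.continuous hLip hu q.continuous
      (herr h hh hh0 q hq hend horth) (tn + h) ⟨by linarith, le_rfl⟩
    rw [← hend] at h1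
    refine h1.trans ?_
    norm_num
    nlinarith [sq_nonneg h]
  · have huc : Continuous u := continuous_iff_continuousAt.2 fun t => (hu t).continuousAt
    set A : ℝ → ℝ := fun t => fderiv ℝ (Function.uncurry f) (t, u t) (0, 1) with hAdef
    have hu' : ContDiff ℝ ((n + 1 : ℕ) : WithTop ℕ∞) u :=
      (contDiff_of_hasDerivAt_comp hu hf').of_le
        (by exact_mod_cast (by omega : n + 1 ≤ 2 * (n + 1) + 1 + 1))
    have hA : ContDiff ℝ ((n + 1 : ℕ) : WithTop ℕ∞) A :=
      ((hf'.fderiv_right (m := ((n + 1 : ℕ) : WithTop ℕ∞))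
        (by exact_mod_cast (by omega : n + 1 + 1 ≤ 2 * (n + 1) + 1))).comp
          (contDiff_id.prodMk hu')).clm_apply contDiff_const
    have hAc := hA.continuous
    have hB : ContDiff ℝ ((n + 1 : ℕ) : WithTop ℕ∞) fun t => ∫ x in tn..t, A x :=
      (contDiff_of_hasDerivAt_comp (f := fun t _ => A t)
        (fun t => (hAc.integral_hasStrictDerivAt tn t).hasDerivAt)
        (hA.comp contDiff_fst)).of_le (by exact_mod_cast Nat.le_succ _)
    have hBc := hB.continuous
    have hg : ContDiff ℝ (n + 1) fun t => Real.exp (-∫ x in tn..t, A x) * A t := by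
      exact_mod_cast hB.neg.exp.mul hA
    obtain ⟨L, hL0, hL⟩ := exists_linearization_bound
      (hf'.of_le (by exact_mod_cast (by omega : 2 ≤ 2 * (n + 1) + 1))) huc tn
    obtain ⟨c₂, hc₂, hG⟩ := exists_integral_orthogonal_bound hg tn
    obtain ⟨Φ, hΦ⟩ := (isCompact_Icc (a := tn) (b := tn + 1)).exists_bound_of_continuousOn
      (f := fun t => Real.exp (-∫ x in tn..t, A x)) (by fun_prop)
    obtain ⟨Ψ, hΨ⟩ := (isCompact_Icc (a := tn) (b := tn + 1)).exists_bound_of_continuousOn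
      (f := fun t => Real.exp (∫ x in tn..t, A x)) (by fun_prop)
    have hΦ0 : 0 ≤ Φ := (norm_nonneg _).trans (hΦ tn (by simp))
    have hΨ0 : 0 ≤ Ψ := (norm_nonneg _).trans (hΨ tn (by simp))
    refine ⟨Ψ * (Φ * L * c ^ 2 + c₂ * (Λ + 1) * c) + 1, by positivity, min h₀ (1 / (c + 1)),
      by positivity, fun h hh hh0 q hq hw => ?_⟩
    have hhh₀ : h ≤ h₀ := hh0.trans (min_le_left _ _)
    have hh1 : h ≤ 1 := hhh₀.trans hh₀1
    have hch : h * (c + 1) ≤ 1 := (le_div_iff₀ (by positivity)).1 (hh0.trans (min_le_right _ _))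
    obtain ⟨hend, horth⟩ := radau_of_weak_formulation (hcF q) hw
    have hE := herr h hh hhh₀ q hq hend horth
    have hW := abs_sub_primitive_le hf.continuous hLip hu q.continuous hE
    set E := c * h ^ (n + 1 + 1) with hEdef
    have hE0 : 0 ≤ E := by positivity
    have hE1 : E ≤ 1 := by
      have : h ^ (n + 1 + 1) ≤ h := pow_le_of_le_one hh.le hh1 (by omega)
      nlinarith
    set w : ℝ → ℝ := fun t => u tn + ∫ x in tn..t, f x (q.eval x) with hwdef
    have hwd : ∀ t, HasDerivAt w (f t (q.eval t)) t := fun t =>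
      ((hcF q).integral_hasStrictDerivAt tn t).hasDerivAt.const_add _
    have hwc : Continuous w := continuous_iff_continuousAt.2 fun t => (hwd t).continuousAt
    have hR : ∀ x ∈ Icc tn (tn + h), |q.eval x - w x| ≤ (Λ + 1) * E := fun x hx => by
      have h1 := abs_le.1 (hE x hx)
      have h2 := abs_le.1 (hW x hx)
      have h3 : Λ * E * h ≤ Λ * E := mul_le_of_le_one_right (by positivity) hh1
      exact abs_le.2 ⟨by linarith, by linarith⟩
    have hfu : Continuous fun x => f x (u x) := hf.continuous.comp (continuous_id.prodMk huc)
    have hfq := hcF q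
    have hvar := mul_exp_neg_primitive_eq_integral (a := tn) (b := tn + h) hAc
      (fun t => (hu t).sub (hwd t)) (hfu.sub hfq) (by simp [hwdef])
    set φ : ℝ → ℝ := fun t => Real.exp (-∫ x in tn..t, A x) with hφdef
    have hφc : Continuous φ := by fun_prop
    have hsplit : ∫ t in tn..(tn + h), φ t * ((f t (u t) - f t (q.eval t)) - A t * (u t - w t))
        = (∫ t in tn..(tn + h), φ t * (f t (u t) - f t (q.eval t) - A t * (u t - q.eval t)))
          - ∫ t in tn..(tn + h), φ t * A t * (q.eval t - w t) := by
      rw [← intervalIntegral.integral_sub ((by fun_prop : Continuous _).intervalIntegrable _ _)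
        ((by fun_prop : Continuous _).intervalIntegrable _ _)]
      exact intervalIntegral.integral_congr fun t _ => by ring
    have hquad : |∫ t in tn..(tn + h),
        φ t * (f t (u t) - f t (q.eval t) - A t * (u t - q.eval t))| ≤ Φ * (L * E ^ 2) * h := by
      rw [← Real.norm_eq_abs]
      refine (intervalIntegral.norm_integral_le_of_norm_le_const (C := Φ * (L * E ^ 2))
        fun t ht => ?_).trans (by simp [abs_of_pos hh])
      rw [uIoc_of_le (by linarith)] at ht
      have ht1 : t ∈ Icc tn (tn + 1) := ⟨ht.1.le, by linarith [ht.2]⟩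
      have hEt : |q.eval t - u t| ≤ E := by
        rw [abs_sub_comm]; exact hE t ⟨ht.1.le, ht.2⟩
      rw [norm_mul]
      refine mul_le_mul (hΦ t ht1) ?_ (norm_nonneg _) hΦ0
      have := hL t ht1 (q.eval t) (hEt.trans hE1)
      rw [Real.norm_eq_abs, abs_sub_comm]
      refine (le_of_eq ?_).trans (this.trans (mul_le_mul_of_nonneg_left ?_ hL0))
      · congr 1
        simp only [hAdef]
        ring
      · rw [← sq_abs]
        gcongr
    have horth' := hG h ((Λ + 1) * E) (fun t => q.eval t - w t) hh hh1 (by fun_prop) hR horth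
    have hfin : |u (tn + h) - q.eval (tn + h)| * φ (tn + h)
        ≤ Φ * (L * E ^ 2) * h + c₂ * h ^ (n + 1) * ((Λ + 1) * E) * h := by
      rw [← abs_of_pos (show 0 < φ (tn + h) from Real.exp_pos _), ← abs_mul, hend]
      refine (le_of_eq (congrArg _ (hvar.trans hsplit))).trans ?_
      exact (abs_sub _ _).trans (add_le_add hquad horth')
    have hinv : φ (tn + h) * Real.exp (∫ x in tn..(tn + h), A x) = 1 := by
      rw [hφdef, ← Real.exp_add]; simp
    have hΨ' : Real.exp (∫ x in tn..(tn + h), A x) ≤ Ψ :=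
      (le_abs_self _).trans (hΨ (tn + h) ⟨by linarith, by linarith⟩)
    have hpow : E ^ 2 * h ≤ c ^ 2 * h ^ (2 * (n + 1) + 2) := by
      have : E ^ 2 * h = c ^ 2 * h ^ (2 * (n + 1) + 2) * h := by rw [hEdef]; ring
      rw [this]
      exact mul_le_of_le_one_right (by positivity) hh1
    calc |u (tn + h) - q.eval (tn + h)|
        = |u (tn + h) - q.eval (tn + h)| * φ (tn + h) * Real.exp (∫ x in tn..(tn + h), A x) := by
          rw [mul_assoc, hinv, mul_one]
      _ ≤ (Φ * (L * E ^ 2) * h + c₂ * h ^ (n + 1) * ((Λ + 1) * E) * h) * Ψ := by gcongr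
      _ = Ψ * (Φ * L * (E ^ 2 * h) + c₂ * (Λ + 1) * c * h ^ (2 * (n + 1) + 2)) := by
          rw [hEdef]; ring
      _ ≤ Ψ * (Φ * L * (c ^ 2 * h ^ (2 * (n + 1) + 2))
            + c₂ * (Λ + 1) * c * h ^ (2 * (n + 1) + 2)) := by gcongr
      _ ≤ (Ψ * (Φ * L * c ^ 2 + c₂ * (Λ + 1) * c) + 1) * h ^ (2 * (n + 1) + 2) := by
          have : 0 ≤ h ^ (2 * (n + 1) + 2) := by positivity
          linarith
end

section
/- (Lemma on the exact-integral Picard iteration, DG-Ex0.) Fix p ≥ 0, nodes −1 < s_0 < ⋯ < s_p = 1 with Lagrange basis ℓ_0, …, ℓ_p, and assume the matrix L with L_{ij} = ∫_{−1}^{1} ℓ_i′ ℓ_j dt − δ_{ip} δ_{jp} is invertible. Let f be C^{2p+1} and globally Lipschitz in its second argument, fix t_n and a value u_n, and for h > 0 set t_{n,m} = t_n + (h/2)(s_m + 1), B = u_n (ℓ_0(−1), …, ℓ_p(−1))^T, and F(U)_j = ∫_{−1}^{1} f(t_n + (h/2)(s+1), ∑_{m=0}^{p} U_m ℓ_m(s))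 ℓ_j(s) ds. Suppose for each h the vector U_h(h) satisfies L U_h + (h/2) F(U_h) + B = 0 (the nodal values of the DG approximation), and define iterates by U^0_m = u_n + (t_{n,m} − t_n) f(t_n, u_n) (explicit Euler) and U^{k+1} = −(h/2) L^{−1} F(U^k) − L^{−1} B. Then for each fixed K ≥ 0 there exist C > 0 and h_0 > 0 such that for all 0 < h ≤ h_0, max_{0 ≤ m ≤ p} |(U_h(h))_m − (U^K(h))_m| ≤ C h^{K+2}. -/
open Polynomial in
/-- Lagrange interpolation at `p + 1` distinct nodes reproduces polynomials of degree at most `p`. -/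
theorem sum_C_eval_mul_lagrange {p : ℕ} {s : Fin (p + 1) → ℝ} (hs : Function.Injective s)
    {ℓ : Fin (p + 1) → ℝ[X]} (hdeg : ∀ i, (ℓ i).natDegree ≤ p)
    (hval : ∀ i j, (ℓ i).eval (s j) = if i = j then 1 else 0)
    {q : ℝ[X]} (hq : q.natDegree ≤ p) :
    ∑ j, C (q.eval (s j)) * ℓ j = q := by
  refine eq_of_natDegree_lt_card_of_eval_eq _ _ hs (fun i => ?_) ?_
  · simp [eval_finsetSum, hval]
  · rw [Fintype.card_fin, max_lt_iff]
    refine ⟨Nat.lt_succ_of_le (natDegree_sum_le_of_forall_le _ _ fun j _ => ?_),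
      Nat.lt_succ_of_le hq⟩
    exact (natDegree_C_mul_le _ _).trans (hdeg j)

/-- The DG matrix applied to the nodal values of an affine function `a + b (x + 1)`. -/
theorem dg_mulVec_affine {p : ℕ} {s : Fin (p + 1) → ℝ}
    (hs : StrictMono s) (hsp : s (Fin.last p) = 1)
    {ℓ : Fin (p + 1) → Polynomial ℝ}
    (hdeg : ∀ i, (ℓ i).natDegree ≤ p)
    (hval : ∀ i j, (ℓ i).eval (s j) = if i = j then 1 else 0)
    {L : Matrix (Fin (p + 1)) (Fin (p + 1)) ℝ}
    (hL : ∀ i j, L i j =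
      (∫ x in (-1:ℝ)..1, (Polynomial.derivative (ℓ i)).eval x * (ℓ j).eval x)
        - (if i = Fin.last p then (1:ℝ) else 0) * (if j = Fin.last p then (1:ℝ) else 0))
    (a b : ℝ) (i : Fin (p + 1)) :
    L.mulVec (fun m => a + b * (s m + 1)) i =
      -(b * ∫ x in (-1:ℝ)..1, (ℓ i).eval x) - a * (ℓ i).eval (-1) := by
  have hint : ∀ x : ℝ, ∑ j, (ℓ i).derivative.eval x * ((a + b * (s j + 1)) * (ℓ j).eval x) =
      (ℓ i).derivative.eval x * (a + b * (x + 1)) := by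
    intro x
    rcases Nat.eq_zero_or_pos p with rfl | hp
    · rw [Polynomial.derivative_of_natDegree_zero (Nat.le_zero.mp (hdeg i))]
      simp
    · have hq : (Polynomial.C a + Polynomial.C b * (Polynomial.X + 1)).natDegree ≤ p := by
        refine le_trans ?_ (Nat.succ_le_of_lt hp)
        compute_degree
      have := congrArg (Polynomial.eval x) (sum_C_eval_mul_lagrange hs.injective hdeg hval hq)
      simp only [Polynomial.eval_finsetSum, Polynomial.eval_mul, Polynomial.eval_C,
        Polynomial.eval_add, Polynomial.eval_X, Polynomial.eval_one] at this
      rw [← Finset.mul_sum, this]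
  have hparts : (∫ x in (-1:ℝ)..1, (ℓ i).derivative.eval x * (a + b * (x + 1))) =
      (a + b * (1 + 1)) * (ℓ i).eval 1 - (a + b * (-1 + 1)) * (ℓ i).eval (-1)
        - ∫ x in (-1:ℝ)..1, b * (ℓ i).eval x := by
    simp_rw [mul_comm _ (a + b * _)]
    refine intervalIntegral.integral_mul_deriv_eq_deriv_mul
      (u := fun x => a + b * (x + 1)) (u' := fun _ => b) (fun x _ => ?_)
      (fun x _ => (ℓ i).hasDerivAt x) (continuous_const.intervalIntegrable _ _)
      ((ℓ i).derivative.continuous.intervalIntegrable _ _)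
    simpa using (((hasDerivAt_id x).add_const (1:ℝ)).const_mul b).const_add a
  have hone : (ℓ i).eval 1 = if i = Fin.last p then (1:ℝ) else 0 := by
    simpa only [hsp] using hval i (Fin.last p)
  have hsum : (∑ j, (∫ x in (-1:ℝ)..1, (ℓ i).derivative.eval x * (ℓ j).eval x) *
      (a + b * (s j + 1))) = ∫ x in (-1:ℝ)..1, (ℓ i).derivative.eval x * (a + b * (x + 1)) := by
    simp_rw [← hint]
    rw [intervalIntegral.integral_finsetSum]
    · refine Finset.sum_congr rfl fun j _ => ?_
      rw [← intervalIntegral.integral_mul_const]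
      exact intervalIntegral.integral_congr fun x _ => by ring
    · exact fun j _ => ((ℓ i).derivative.continuous.mul
        (continuous_const.mul (ℓ j).continuous)).intervalIntegrable _ _
  have hdelta : (∑ j, (if i = Fin.last p then (1:ℝ) else 0) *
      (if j = Fin.last p then (1:ℝ) else 0) * (a + b * (s j + 1))) =
      (if i = Fin.last p then (1:ℝ) else 0) * (a + b * (1 + 1)) := by
    simp [hsp]
  simp only [Matrix.mulVec, dotProduct, hL, sub_mul, Finset.sum_sub_distrib]
  rw [hsum, hdelta, hparts, hone, intervalIntegral.integral_const_mul]
  ring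

theorem exists_norm_le_mul_norm_mulVec {n : Type*} [Fintype n] [DecidableEq n]
    (L : Matrix n n ℝ) (hL : IsUnit L.det) :
    ∃ G : ℝ, 0 ≤ G ∧ ∀ x : n → ℝ, ‖x‖ ≤ G * ‖L.mulVec x‖ := by
  let T := (Matrix.toLin' L⁻¹).toContinuousLinearMap
  refine ⟨‖T‖, norm_nonneg _, fun x => ?_⟩
  have h : T (L.mulVec x) = x := by
    simp [T, Matrix.mulVec_mulVec, Matrix.nonsing_inv_mul L hL]
  simpa [h] using T.le_opNorm (L.mulVec x)

theorem exists_abs_eval_le {p : ℕ} (ℓ : Fin (p + 1) → Polynomial ℝ) :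
    ∃ Q : ℝ, 0 ≤ Q ∧ ∀ j, ∀ x ∈ Set.Icc (-1:ℝ) 1, |(ℓ j).eval x| ≤ Q := by
  have hcont : Continuous fun x : ℝ => fun j => (ℓ j).eval x :=
    continuous_pi fun j => (ℓ j).continuous
  obtain ⟨Q, hQ⟩ := (isCompact_Icc (a := (-1:ℝ)) (b := 1)).exists_bound_of_continuousOn
    hcont.continuousOn
  refine ⟨Q, (norm_nonneg _).trans (hQ 0 (by norm_num)), fun j x hx => ?_⟩
  simpa using (norm_le_pi_norm (fun j => (ℓ j).eval x) j).trans (hQ x hx)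

theorem abs_integral_mul_sub_integral_mul_le {g₁ g₂ q : ℝ → ℝ} (hg₁ : Continuous g₁)
    (hg₂ : Continuous g₂) (hq : Continuous q) {D Q : ℝ} (hD : 0 ≤ D)
    (hg : ∀ x ∈ Set.Icc (-1:ℝ) 1, |g₁ x - g₂ x| ≤ D)
    (hqQ : ∀ x ∈ Set.Icc (-1:ℝ) 1, |q x| ≤ Q) :
    |(∫ x in (-1:ℝ)..1, g₁ x * q x) - ∫ x in (-1:ℝ)..1, g₂ x * q x| ≤ D * Q * 2 := by
  have h₁ : Continuous fun x => g₁ x * q x := hg₁.mul hq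
  have h₂ : Continuous fun x => g₂ x * q x := hg₂.mul hq
  rw [← intervalIntegral.integral_sub (h₁.intervalIntegrable _ _) (h₂.intervalIntegrable _ _)]
  have h := intervalIntegral.norm_integral_le_of_norm_le_const (a := (-1:ℝ)) (b := 1)
    (f := fun x => g₁ x * q x - g₂ x * q x) (C := D * Q) fun x hx => by
      rw [Set.uIoc_of_le (by norm_num)] at hx
      have hx' : x ∈ Set.Icc (-1:ℝ) 1 := ⟨hx.1.le, hx.2⟩
      rw [← sub_mul, Real.norm_eq_abs, abs_mul]
      exact mul_le_mul (hg x hx') (hqQ x hx') (abs_nonneg _) hD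
  refine h.trans_eq ?_
  norm_num


/-- DG-Ex0: Convergence of the exact-integral Picard iteration towards the
DG nodal values. With `U_h(h)` the DG nodal solution of `L U + (h/2) F(U) + B = 0` and the
iterates `U⁰` given by explicit Euler, `U^{k+1} = -(h/2) L⁻¹ F(U^k) - L⁻¹ B`, for each
fixed `K` there are `C > 0` and `h₀ > 0` with
`max_m |(U_h(h))_m - (U^K(h))_m| ≤ C h^{K+2}` for all `0 < h ≤ h₀`. -/
theorem dg_picard_exact_integral_error (p : ℕ) (s : Fin (p + 1) → ℝ)
    (hs : StrictMono s) (hs0 : (-1 : ℝ) < s 0) (hsp : s (Fin.last p) = 1)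
    (ℓ : Fin (p + 1) → Polynomial ℝ)
    (hdeg : ∀ i, (ℓ i).natDegree ≤ p)
    (hval : ∀ i j, (ℓ i).eval (s j) = if i = j then 1 else 0)
    (L : Matrix (Fin (p + 1)) (Fin (p + 1)) ℝ)
    (hLdef : ∀ i j, L i j =
      (∫ x in (-1:ℝ)..1, (Polynomial.derivative (ℓ i)).eval x * (ℓ j).eval x)
        - (if i = Fin.last p then (1:ℝ) else 0) * (if j = Fin.last p then (1:ℝ) else 0))
    (hLinv : IsUnit L.det)
    (f : ℝ → ℝ → ℝ) (Λ : NNReal)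
    (hf : ContDiff ℝ (2 * p + 1) (Function.uncurry f))
    (hLip : ∀ t, LipschitzWith Λ (f t))
    (tn un : ℝ)
    (B : Fin (p + 1) → ℝ) (hB : ∀ i, B i = un * (ℓ i).eval (-1))
    (F : ℝ → (Fin (p + 1) → ℝ) → Fin (p + 1) → ℝ)
    (hF : ∀ h U j, F h U j = ∫ x in (-1:ℝ)..1,
      f (tn + h / 2 * (x + 1)) (∑ m, U m * (ℓ m).eval x) * (ℓ j).eval x)
    (Uh : ℝ → Fin (p + 1) → ℝ)
    (hUh : ∀ h : ℝ, 0 < h → L.mulVec (Uh h) + (h / 2) • F h (Uh h) + B = 0)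
    (U : ℝ → ℕ → Fin (p + 1) → ℝ)
    (hU0 : ∀ h m, U h 0 m = un + (h / 2 * (s m + 1)) * f tn un)
    (hUk : ∀ h k, U h (k + 1) = -((h / 2) • L⁻¹.mulVec (F h (U h k))) - L⁻¹.mulVec B)
    (K : ℕ) :
    ∃ C > 0, ∃ h₀ > 0, ∀ h : ℝ, 0 < h → h ≤ h₀ →
      ∀ m, |Uh h m - U h K m| ≤ C * h ^ (K + 2) := by
  obtain ⟨G, hG0, hG⟩ := exists_norm_le_mul_norm_mulVec L hLinv
  obtain ⟨Q, hQ0, hQ⟩ := exists_abs_eval_le ℓ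
  have hfc : Continuous (Function.uncurry f) := hf.continuous
  have hcont : ∀ h (V : Fin (p + 1) → ℝ), Continuous fun x : ℝ =>
      f (tn + h / 2 * (x + 1)) (∑ m, V m * (ℓ m).eval x) := by
    intro h V
    have hsum : Continuous fun x : ℝ => ∑ m, V m * (ℓ m).eval x :=
      continuous_finsetSum _ fun m _ => continuous_const.mul (ℓ m).continuous
    have htime : Continuous fun x : ℝ => tn + h / 2 * (x + 1) := by fun_prop
    exact hfc.comp (htime.prodMk hsum)
  -- Lipschitz continuity of the load vector in the nodal values
  obtain ⟨A, hA0, hA⟩ : ∃ A : ℝ, 0 ≤ A ∧ ∀ h V W, ‖F h V - F h W‖ ≤ A * ‖V - W‖ := by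
    refine ⟨Λ * ((p + 1) * Q) * Q * 2, by positivity, fun h V W => ?_⟩
    refine (pi_norm_le_iff_of_nonneg (by positivity)).2 fun j => ?_
    rw [Pi.sub_apply, hF, hF, Real.norm_eq_abs]
    refine (abs_integral_mul_sub_integral_mul_le (hcont h V) (hcont h W) (ℓ j).continuous
      (D := Λ * ((p + 1) * Q * ‖V - W‖)) (by positivity) (fun x hx => ?_) (hQ j)).trans_eq
        (by ring)
    refine ((hLip _).dist_le_mul _ _).trans ?_
    refine mul_le_mul_of_nonneg_left ?_ Λ.2
    rw [Real.dist_eq, ← Finset.sum_sub_distrib]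
    refine (Finset.abs_sum_le_sum_abs _ _).trans ?_
    refine (Finset.sum_le_card_nsmul _ _ (‖V - W‖ * Q) fun m _ => ?_).trans_eq ?_
    · rw [← sub_mul, abs_mul]
      exact mul_le_mul (norm_le_pi_norm (V - W) m) (hQ m x hx) (abs_nonneg _) (norm_nonneg _)
    · simp; ring
  have hsum1 : ∀ x : ℝ, ∑ m, un * (ℓ m).eval x = un := fun x => by
    have h := congrArg (Polynomial.eval x)
      (sum_C_eval_mul_lagrange hs.injective hdeg hval (q := 1) (by simp))
    simp only [Polynomial.eval_one, Polynomial.C_1, one_mul, Polynomial.eval_finsetSum] at h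
    rw [← Finset.mul_sum, h, mul_one]
  -- variation in `h` of the load vector at the constant state `un`
  obtain ⟨M, hM0, δ, hδ, hM⟩ : ∃ M : ℝ, 0 ≤ M ∧ ∃ δ > 0, ∀ h, 0 < h → h ≤ δ →
      ‖F h (fun _ => un) - F 0 (fun _ => un)‖ ≤ M * h := by
    have hdiff : DifferentiableAt ℝ (fun t => f t un) tn := by
      have h1 : Differentiable ℝ (Function.uncurry f) := hf.differentiable (by simp)
      exact (h1.comp (differentiable_id.prodMk (differentiable_const un))) tn
    obtain ⟨c, hc0, hc⟩ := hdiff.isBigO_sub.exists_pos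
    obtain ⟨δ, hδ, hball⟩ := Metric.eventually_nhds_iff.1 hc.bound
    refine ⟨c * Q * 2, by positivity, δ / 2, by positivity, fun h hh hhδ => ?_⟩
    refine (pi_norm_le_iff_of_nonneg (by positivity)).2 fun j => ?_
    rw [Pi.sub_apply, hF, hF, Real.norm_eq_abs]
    refine (abs_integral_mul_sub_integral_mul_le (hcont h _) (hcont 0 _) (ℓ j).continuous
      (D := c * h) (by positivity) (fun x hx => ?_) (hQ j)).trans_eq (by ring)
    have hx0 : 0 ≤ h / 2 * (x + 1) := mul_nonneg (by positivity) (by linarith [hx.1])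
    have hx1 : h / 2 * (x + 1) ≤ h := by nlinarith [hx.2]
    have hb := hball (y := tn + h / 2 * (x + 1)) (by
      rw [Real.dist_eq, add_sub_cancel_left, abs_of_nonneg hx0]; linarith)
    rw [add_sub_cancel_left, Real.norm_eq_abs, Real.norm_eq_abs, abs_of_nonneg hx0] at hb
    simp only [hsum1, zero_div, zero_mul, add_zero]
    exact hb.trans (mul_le_mul_of_nonneg_left hx1 hc0.le)
  have hLU : ∀ h, L.mulVec (U h 0) = -((h / 2) • F 0 (fun _ => un)) - B := fun h => by
    have hU : U h 0 = fun m => un + h / 2 * f tn un * (s m + 1) := by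
      ext m; rw [hU0]; ring
    ext i
    rw [hU, dg_mulVec_affine hs hsp hdeg hval hLdef]
    simp only [Pi.sub_apply, Pi.neg_apply, Pi.smul_apply, smul_eq_mul, hF, hB, hsum1, zero_div,
      zero_mul, add_zero, intervalIntegral.integral_const_mul]
    ring
  have hLUk : ∀ h k, L.mulVec (U h (k + 1)) = -((h / 2) • F h (U h k)) - B := fun h k => by
    rw [hUk, Matrix.mulVec_sub, Matrix.mulVec_neg, Matrix.mulVec_smul, Matrix.mulVec_mulVec,
      Matrix.mulVec_mulVec, Matrix.mul_nonsing_inv L hLinv, Matrix.one_mulVec, Matrix.one_mulVec]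
  have hstab : ∀ h, 0 < h → ∀ V Y, L.mulVec V = -((h / 2) • Y) - B →
      ‖Uh h - V‖ ≤ G * (h / 2 * ‖F h (Uh h) - Y‖) := fun h hh V Y hV => by
    refine (hG _).trans_eq ?_
    have hUh' : L.mulVec (Uh h) = -((h / 2) • F h (Uh h)) - B := by
      rw [← sub_eq_zero, ← hUh h hh]; abel
    rw [Matrix.mulVec_sub, hUh', hV, sub_sub_sub_cancel_right, neg_sub_neg, ← smul_sub, norm_smul,
      norm_sub_rev, Real.norm_of_nonneg (by positivity)]
  have hbase : ∀ h, 0 < h → h ≤ min δ (1 / (G * A + 1)) →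
      ‖Uh h - U h 0‖ ≤ G * (A * |f tn un| + M) * h ^ 2 := fun h hh hle => by
    have hconst : ‖U h 0 - fun _ => un‖ ≤ |f tn un| * h := by
      refine (pi_norm_le_iff_of_nonneg (by positivity)).2 fun m => ?_
      have hm0 : -1 < s m := hs0.trans_le (hs.monotone (Fin.zero_le m))
      have hm1 : s m ≤ 1 := hsp ▸ hs.monotone (Fin.le_last m)
      rw [Pi.sub_apply, hU0, add_sub_cancel_left, Real.norm_eq_abs, abs_mul,
        abs_of_nonneg (mul_nonneg (by positivity) (by linarith)), mul_comm]
      exact mul_le_mul_of_nonneg_left (by nlinarith) (abs_nonneg _)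
    have hload : ‖F h (Uh h) - F 0 (fun _ => un)‖ ≤
        A * (‖Uh h - U h 0‖ + |f tn un| * h) + M * h := by
      refine (norm_sub_le_norm_sub_add_norm_sub _ (F h fun _ => un) _).trans ?_
      refine add_le_add ((hA _ _ _).trans (mul_le_mul_of_nonneg_left ?_ hA0))
        (hM h hh (hle.trans (min_le_left _ _)))
      exact (norm_sub_le_norm_sub_add_norm_sub _ (U h 0) _).trans (by gcongr)
    have hGA : 0 ≤ G * A := mul_nonneg hG0 hA0
    have hsmall : G * A * h ≤ 1 := by
      have h1 := (le_div_iff₀ (by positivity)).1 (hle.trans (min_le_right _ _))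
      nlinarith
    have hE := (hstab h hh _ _ (hLU h)).trans (mul_le_mul_of_nonneg_left
      (mul_le_mul_of_nonneg_left hload (by positivity)) hG0)
    nlinarith [mul_le_mul_of_nonneg_right hsmall (norm_nonneg (Uh h - U h 0))]
  have hC : 0 ≤ G * (A * |f tn un| + M) := by positivity
  have hiter : ∀ h, 0 < h → h ≤ min δ (1 / (G * A + 1)) → ∀ k,
      ‖Uh h - U h k‖ ≤ G * (A * |f tn un| + M) * (G * A / 2) ^ k * h ^ (k + 2) := by
    intro h hh hle k
    induction k with
    | zero => simpa using hbase h hh hle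
    | succ k ih =>
      calc ‖Uh h - U h (k + 1)‖ ≤ G * (h / 2 * (A * ‖Uh h - U h k‖)) :=
            (hstab h hh _ _ (hLUk h k)).trans (by gcongr; exact hA _ _ _)
        _ ≤ G * (h / 2 * (A * (G * (A * |f tn un| + M) * (G * A / 2) ^ k * h ^ (k + 2)))) := by
            gcongr
        _ = _ := by ring
  refine ⟨G * (A * |f tn un| + M) * (G * A / 2) ^ K + 1, by positivity,
    min δ (1 / (G * A + 1)), lt_min hδ (by positivity), fun h hh hle m => ?_⟩
  have hm := (norm_le_pi_norm (Uh h - U h K) m).trans (hiter h hh hle K)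
  rw [Pi.sub_apply, Real.norm_eq_abs] at hm
  refine hm.trans ?_
  gcongr
  linarith
end

section
/- (Local truncation error of the explicit DG scheme, DG-Ex2.) Under the setting of the quadrature-based explicit DG iteration (p ≥ 0; Gauß–Radau quadrature on [−1,1] with nodes −1 < s_0 < ⋯ < s_p = 1 and positive weights exact for degree 2p; L invertible; f of class C^{2p+1} and globally Lipschitz in its second argument; u the exact solution of u′ = f(t,u) with value u(t_n) = u_n; iterates U^0 given by explicit Euler and U^{k+1} = −(h/2) L^{−1} F_ω(U^k) − L^{−1} B), for each fixed K ≥ 0 there exist C > 0 and h_0 > 0 such that for all 0 < h ≤ h_0: |u(t_{n,m}) − (U^K(h))_m| ≤ C h^{min(p+2, K+2)} for 0 ≤ m ≤ p−1, and at the right endpoint |u(t_n + h) − (U^K(h))_p| ≤ C h^{min(2p+2, K+2)}. -/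
open Filter Topology Asymptotics Finset Polynomial

lemma isBigO_pow_pow_nhdsGT_zero {m n : ℕ} (hmn : n ≤ m) :
    (fun h : ℝ => h ^ m) =O[𝓝[>] 0] fun h => h ^ n := by
  refine IsBigO.of_bound 1 ?_
  filter_upwards [Ioo_mem_nhdsGT (zero_lt_one' ℝ)] with h hh
  rw [one_mul, norm_pow, norm_pow, Real.norm_of_nonneg hh.1.le]
  exact pow_le_pow_of_le_one hh.1.le hh.2.le hmn

lemma taylor_sum_isBigO {g : ℝ → ℝ} {n : ℕ} (hg : ContDiff ℝ n g) (t c : ℝ) :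
    (fun h : ℝ => g (t + h * c) -
        ∑ k ∈ range n, iteratedDeriv k g t / (k.factorial : ℝ) * (h * c) ^ k)
      =O[𝓝[>] 0] fun h => h ^ n := by
  have hlim : Tendsto (fun h : ℝ => t + h * c) (𝓝[>] 0) (𝓝 t) := by
    have hc : Continuous fun h : ℝ => t + h * c := by fun_prop
    simpa using (hc.tendsto 0).mono_left nhdsWithin_le_nhds
  have hpow : (fun h : ℝ => (h * c) ^ n) =O[𝓝[>] 0] fun h => h ^ n := by
    simp_rw [mul_pow, mul_comm _ (c ^ n)]
    exact (isBigO_refl _ _).const_mul_left _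
  have h1 := ((taylor_isLittleO_univ (x₀ := t) hg).comp_tendsto hlim).isBigO
  simp only [Function.comp_def, add_sub_cancel_left] at h1
  have h2 := (h1.trans hpow).add
    (hpow.const_mul_left (iteratedDeriv n g t / (n.factorial : ℝ)))
  refine h2.congr_left fun h => ?_
  rw [taylor_within_apply, sum_range_succ]
  simp only [iteratedDerivWithin_univ, add_sub_cancel_left, smul_eq_mul]
  have : ∀ k ∈ range n, ((k.factorial : ℝ)⁻¹ * (h * c) ^ k) * iteratedDeriv k g t
    = iteratedDeriv k g t / (k.factorial : ℝ) * (h * c) ^ k := fun k _ => by ring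
  rw [sum_congr rfl this]
  ring

lemma contDiff_succ_of_hasDerivAt {f : ℝ → ℝ → ℝ} {n : ℕ}
    (hf : ContDiff ℝ n (Function.uncurry f)) {u : ℝ → ℝ}
    (hu : ∀ t, HasDerivAt u (f t (u t)) t) : ContDiff ℝ (n + 1) u := by
  have hd : deriv u = fun t => Function.uncurry f (t, u t) := funext fun t => (hu t).deriv
  have key : ∀ k : ℕ, k ≤ n + 1 → ContDiff ℝ k u := by
    intro k
    induction k with
    | zero =>
      intro _
      exact contDiff_zero.2 (continuous_iff_continuousAt.2 fun t => (hu t).continuousAt)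
    | succ k ih =>
      intro hk
      push_cast
      rw [contDiff_succ_iff_deriv]
      refine ⟨fun t => (hu t).differentiableAt, by simp, ?_⟩
      rw [hd]
      exact (hf.of_le (by exact_mod_cast (by omega : k ≤ n))).comp
        (contDiff_id.prodMk (ih (by omega)))
  exact_mod_cast key (n + 1) le_rfl

lemma ContDiffAt.isBigO_sub_sub_fderiv {E ι : Type*} [NormedAddCommGroup E] [NormedSpace ℝ E]
    {F : E → ℝ} {x₀ : E} (hF : ContDiffAt ℝ 2 F x₀) {l : Filter ι} {x y : ι → E}
    (hx : Tendsto x l (𝓝 x₀)) (hy : Tendsto y l (𝓝 x₀)) :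
    (fun i => F (y i) - F (x i) - fderiv ℝ F (x i) (y i - x i)) =O[l]
      fun i => ‖y i - x i‖ ^ 2 := by
  obtain ⟨K, T, hT, hK⟩ := (hF.fderiv_right (m := 1) (by norm_num)).exists_lipschitzOnWith
  have hd : ∀ᶠ z in 𝓝 x₀, DifferentiableAt ℝ F z :=
    (hF.eventually (by simp)).mono fun z hz => hz.differentiableAt (by norm_num)
  obtain ⟨r, hr, hball⟩ := Metric.mem_nhds_iff.1 (inter_mem hT hd)
  refine IsBigO.of_bound K ?_
  filter_upwards [hx (Metric.ball_mem_nhds x₀ hr), hy (Metric.ball_mem_nhds x₀ hr)] with i hxi hyi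
  have hseg : segment ℝ (x i) (y i) ⊆ Metric.ball x₀ r :=
    (convex_ball x₀ r).segment_subset hxi hyi
  have := (convex_segment (𝕜 := ℝ) (x i) (y i)).norm_image_sub_le_of_norm_fderiv_le'
    (f := F) (φ := fderiv ℝ F (x i)) (C := K * ‖y i - x i‖)
    (fun z hz => (hball (hseg hz)).2) (fun z hz => ?_)
    (left_mem_segment ℝ _ _) (right_mem_segment ℝ _ _)
  · simpa [pow_two, mul_assoc] using this
  · refine (hK.norm_sub_le (hball (hseg hz)).1 (hball hxi).1).trans ?_
    gcongr
    have := norm_sub_le_of_mem_segment hz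
    simpa using this
section PicardRecursion

lemma Asymptotics.IsBigO.mul_pow_nhdsGT_zero {f g : ℝ → ℝ} {a b n : ℕ}
    (hf : f =O[𝓝[>] 0] fun h => h ^ a) (hg : g =O[𝓝[>] 0] fun h => h ^ b) (hn : n ≤ a + b) :
    (fun h => f h * g h) =O[𝓝[>] 0] fun h => h ^ n :=
  ((hf.mul hg).congr_right fun h => (pow_add h a b).symm).trans (isBigO_pow_pow_nhdsGT_zero hn)

variable {p : ℕ} {b c : Fin (p + 1) → ℝ} {A : Matrix (Fin (p + 1)) (Fin (p + 1)) ℝ}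
  {e d : ℕ → Fin (p + 1) → ℝ → ℝ} {δ : Fin (p + 1) → ℝ → ℝ}

lemma stage_error_isBigO
    (hrec : ∀ k i h, e (k + 1) i h = h * ∑ j, A i j * d k j h + δ i h)
    (he0 : ∀ i, e 0 i =O[𝓝[>] 0] fun h => h ^ 2)
    (hd : ∀ k j, d k j =O[𝓝[>] 0] e k j)
    (hδ : ∀ i, δ i =O[𝓝[>] 0] fun h => h ^ (p + 2)) (k : ℕ) (i : Fin (p + 1)) :
    e k i =O[𝓝[>] 0] fun h => h ^ min (p + 2) (k + 2) := by
  induction k generalizing i with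
  | zero => exact (he0 i).trans (isBigO_pow_pow_nhdsGT_zero (by omega))
  | succ k ih =>
    have h1 : (fun h => ∑ j, A i j * d k j h) =O[𝓝[>] 0] fun h => h ^ min (p + 2) (k + 2) :=
      IsBigO.fun_sum fun j _ => ((hd k j).trans (ih j)).const_mul_left _
    have h2 : (fun h : ℝ => h) =O[𝓝[>] 0] fun h => h ^ 1 := by simpa using isBigO_refl _ _
    rw [funext (hrec k i)]
    exact (h2.mul_pow_nhdsGT_zero h1 (by omega)).add
      ((hδ i).trans (isBigO_pow_pow_nhdsGT_zero (by omega)))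

lemma weighted_increment_isBigO {α : ℕ → ℝ} {k : ℕ}
    (hdα : ∀ j, (fun h => d k j h - (∑ l ∈ range p, α l * (h * c j) ^ l) * e k j h)
      =O[𝓝[>] 0] fun h => h ^ min (2 * p + 1) (k + 2))
    (hM : ∀ i, (fun h => ∑ j, b j * c j ^ i * e k j h)
      =O[𝓝[>] 0] fun h => h ^ min (2 * p + 1 - i) (k + 2)) (i : ℕ) :
    (fun h => ∑ j, b j * c j ^ i * d k j h)
      =O[𝓝[>] 0] fun h => h ^ min (2 * p + 1 - i) (k + 2) := by
  have h1 : (fun h => ∑ j, b j * c j ^ i *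
      (d k j h - (∑ l ∈ range p, α l * (h * c j) ^ l) * e k j h))
      =O[𝓝[>] 0] fun h => h ^ min (2 * p + 1 - i) (k + 2) :=
    IsBigO.fun_sum fun j _ => ((hdα j).const_mul_left _).trans
      (isBigO_pow_pow_nhdsGT_zero (by omega))
  have h2 : (fun h => ∑ l ∈ range p, (α l * h ^ l) * ∑ j, b j * c j ^ (i + l) * e k j h)
      =O[𝓝[>] 0] fun h => h ^ min (2 * p + 1 - i) (k + 2) :=
    IsBigO.fun_sum fun l _ =>
      ((isBigO_refl (fun h : ℝ => h ^ l) _).const_mul_left (α l)).mul_pow_nhdsGT_zero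
        (hM (i + l)) (by omega)
  refine (h1.add h2).congr_left fun h => ?_
  simp only [mul_sum, sum_mul, mul_sub, sum_sub_distrib]
  rw [sum_comm (s := range p), sub_add_eq_add_sub, sub_eq_iff_eq_add]
  refine congrArg _ (sum_congr rfl fun j _ => sum_congr rfl fun l _ => ?_)
  ring

lemma moment_error_isBigO {α : ℕ → ℝ}
    (hrec : ∀ k i h, e (k + 1) i h = h * ∑ j, A i j * d k j h + δ i h)
    (he0 : ∀ i, e 0 i =O[𝓝[>] 0] fun h => h ^ 2)
    (hd : ∀ k j, d k j =O[𝓝[>] 0] e k j)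
    (hδ : ∀ i, δ i =O[𝓝[>] 0] fun h => h ^ (p + 2))
    (hdα : ∀ k j, (fun h => d k j h - (∑ l ∈ range p, α l * (h * c j) ^ l) * e k j h)
      =O[𝓝[>] 0] fun h => h ^ min (2 * p + 1) (k + 2))
    (hA : ∀ i < p, ∀ j, ∑ m, b m * c m ^ i * A m j = b j * (1 - c j ^ (i + 1)) / (i + 1))
    (hδm : ∀ i < p, (fun h => ∑ j, b j * c j ^ i * δ j h)
      =O[𝓝[>] 0] fun h => h ^ (2 * p + 1 - i)) (k i : ℕ) :
    (fun h => ∑ j, b j * c j ^ i * e k j h)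
      =O[𝓝[>] 0] fun h => h ^ min (2 * p + 1 - i) (k + 2) := by
  have hstage := stage_error_isBigO hrec he0 hd hδ
  induction k generalizing i with
  | zero =>
    exact IsBigO.fun_sum fun j _ => ((he0 j).const_mul_left _).trans
      (isBigO_pow_pow_nhdsGT_zero (by omega))
  | succ k ih =>
    rcases le_or_gt p i with hi | hi
    · exact IsBigO.fun_sum fun j _ => ((hstage (k + 1) j).const_mul_left _).trans
        (isBigO_pow_pow_nhdsGT_zero (by omega))
    have hN := weighted_increment_isBigO (hdα k) ih
    have h1 : (fun h : ℝ => h) =O[𝓝[>] 0] fun h => h ^ 1 := by simpa using isBigO_refl _ _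
    have h2 := (((h1.mul_pow_nhdsGT_zero (hN 0)
        (n := min (2 * p + 1 - i) (k + 1 + 2)) (by omega)).sub
      (h1.mul_pow_nhdsGT_zero (hN (i + 1)) (by omega))).const_mul_left ((i + 1 : ℝ)⁻¹)).add
      ((hδm i hi).trans (isBigO_pow_pow_nhdsGT_zero (by omega)))
    refine h2.congr_left fun h => ?_
    have h3 : ∑ m, b m * c m ^ i * (h * ∑ j, A m j * d k j h) =
        h * ∑ j, (∑ m, b m * c m ^ i * A m j) * d k j h := by
      simp only [mul_sum, sum_mul]
      rw [sum_comm]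
      exact sum_congr rfl fun j _ => sum_congr rfl fun m _ => by ring
    simp only [hrec, mul_add, sum_add_distrib]
    rw [h3, add_left_inj]
    simp only [hA i hi]
    rw [← mul_sub, ← sum_sub_distrib, mul_left_comm, mul_sum]
    congr 1
    exact sum_congr rfl fun j _ => by ring

lemma endpoint_error_isBigO {α : ℕ → ℝ}
    (hrec : ∀ k i h, e (k + 1) i h = h * ∑ j, A i j * d k j h + δ i h)
    (he0 : ∀ i, e 0 i =O[𝓝[>] 0] fun h => h ^ 2)
    (hd : ∀ k j, d k j =O[𝓝[>] 0] e k j)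
    (hδ : ∀ i, δ i =O[𝓝[>] 0] fun h => h ^ (p + 2))
    (hdα : ∀ k j, (fun h => d k j h - (∑ l ∈ range p, α l * (h * c j) ^ l) * e k j h)
      =O[𝓝[>] 0] fun h => h ^ min (2 * p + 1) (k + 2))
    (hA : ∀ i < p, ∀ j, ∑ m, b m * c m ^ i * A m j = b j * (1 - c j ^ (i + 1)) / (i + 1))
    (hδm : ∀ i < p, (fun h => ∑ j, b j * c j ^ i * δ j h)
      =O[𝓝[>] 0] fun h => h ^ (2 * p + 1 - i))
    (hAlast : ∀ j, A (Fin.last p) j = b j)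
    (hδlast : δ (Fin.last p) =O[𝓝[>] 0] fun h => h ^ (2 * p + 2)) (k : ℕ) :
    e k (Fin.last p) =O[𝓝[>] 0] fun h => h ^ min (2 * p + 2) (k + 2) := by
  cases k with
  | zero => exact (he0 _).trans (isBigO_pow_pow_nhdsGT_zero (by omega))
  | succ k =>
    have hN := weighted_increment_isBigO (hdα k)
      (moment_error_isBigO hrec he0 hd hδ hdα hA hδm k) 0
    have h1 : (fun h : ℝ => h) =O[𝓝[>] 0] fun h => h ^ 1 := by simpa using isBigO_refl _ _
    rw [funext (hrec k (Fin.last p))]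
    simp only [hAlast]
    refine IsBigO.add ?_ (hδlast.trans (isBigO_pow_pow_nhdsGT_zero (by omega)))
    simp only [pow_zero, mul_one] at hN
    exact h1.mul_pow_nhdsGT_zero hN (by omega)

end PicardRecursion

lemma integral_eval_derivative (q : ℝ[X]) (a b : ℝ) :
    ∫ x in a..b, (derivative q).eval x = q.eval b - q.eval a :=
  intervalIntegral.integral_eq_sub_of_hasDerivAt (fun x _ => q.hasDerivAt x)
    ((derivative q).continuous.intervalIntegrable _ _)

section Radau

variable {p : ℕ} {s ω : Fin (p + 1) → ℝ} {ℓ : Fin (p + 1) → ℝ[X]}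
  {L : Matrix (Fin (p + 1)) (Fin (p + 1)) ℝ}

lemma sum_eval_mul_lagrange (hs : Function.Injective s)
    (hdeg : ∀ i, (ℓ i).natDegree ≤ p)
    (hval : ∀ i j, (ℓ i).eval (s j) = if i = j then 1 else 0)
    {q : ℝ[X]} (hq : q.natDegree ≤ p) : ∑ i, C (q.eval (s i)) * ℓ i = q := by
  refine Polynomial.eq_of_degrees_lt_of_eval_index_eq univ (v := s) hs.injOn ?_ ?_ ?_
  · refine (degree_le_of_natDegree_le (n := p) ?_).trans_lt (by simp; exact_mod_cast p.lt_succ_self)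
    exact natDegree_sum_le_of_forall_le _ _ fun i _ => (natDegree_C_mul_le _ _).trans (hdeg i)
  · exact (degree_le_of_natDegree_le hq).trans_lt (by simp; exact_mod_cast p.lt_succ_self)
  · intro j _
    simp [eval_finsetSum, hval]

lemma natDegree_derivative_mul_le {q r : ℝ[X]} {p : ℕ} (hq : q.natDegree ≤ p)
    (hr : r.natDegree ≤ p + 1) : (derivative q * r).natDegree ≤ 2 * p := by
  rcases Nat.eq_zero_or_pos p with rfl | hp
  · rw [derivative_of_natDegree_zero (by omega)]; simp
  · have := natDegree_derivative_le q
    have := natDegree_mul_le (p := derivative q) (q := r)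
    omega

lemma dgMatrix_apply
    (hexact : ∀ q : ℝ[X], q.natDegree ≤ 2 * p →
      ∑ i, ω i * q.eval (s i) = ∫ x in (-1:ℝ)..1, q.eval x)
    (hdeg : ∀ i, (ℓ i).natDegree ≤ p)
    (hval : ∀ i j, (ℓ i).eval (s j) = if i = j then 1 else 0)
    (hL : ∀ i j, L i j =
      (∫ x in (-1:ℝ)..1, (derivative (ℓ i)).eval x * (ℓ j).eval x)
        - (if i = Fin.last p then (1:ℝ) else 0) * (if j = Fin.last p then (1:ℝ) else 0))
    (i j : Fin (p + 1)) :
    L i j = ω j * (derivative (ℓ i)).eval (s j) -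
      (if i = Fin.last p then (1:ℝ) else 0) * (if j = Fin.last p then (1:ℝ) else 0) := by
  have := hexact (derivative (ℓ i) * ℓ j)
    (natDegree_derivative_mul_le (hdeg i) ((hdeg j).trans p.le_succ))
  simp only [eval_mul, hval] at this
  rw [hL, ← this]
  simp

lemma dgMatrix_mulVec_eval (hsp : s (Fin.last p) = 1)
    (hexact : ∀ q : ℝ[X], q.natDegree ≤ 2 * p →
      ∑ i, ω i * q.eval (s i) = ∫ x in (-1:ℝ)..1, q.eval x)
    (hdeg : ∀ i, (ℓ i).natDegree ≤ p)
    (hval : ∀ i j, (ℓ i).eval (s j) = if i = j then 1 else 0)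
    (hL : ∀ i j, L i j =
      (∫ x in (-1:ℝ)..1, (derivative (ℓ i)).eval x * (ℓ j).eval x)
        - (if i = Fin.last p then (1:ℝ) else 0) * (if j = Fin.last p then (1:ℝ) else 0))
    {G : ℝ[X]} (hG : G.natDegree ≤ p + 1) :
    L.mulVec (fun j => G.eval (s j)) =
      fun i => -((ℓ i).eval (-1) * G.eval (-1)) - ω i * (derivative G).eval (s i) := by
  funext i
  have hp := hexact (derivative (ℓ i) * G) (natDegree_derivative_mul_le (hdeg i) hG)
  have hq := hexact (ℓ i * derivative G) (by
    have := natDegree_derivative_le G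
    have := natDegree_mul_le (p := ℓ i) (q := derivative G)
    have := hdeg i
    omega)
  have hi := integral_eval_derivative (ℓ i * G) (-1) 1
  have hsum := intervalIntegral.integral_add (μ := MeasureTheory.volume)
    ((derivative (ℓ i) * G).continuous.intervalIntegrable (-1) 1)
    ((ℓ i * derivative G).continuous.intervalIntegrable (-1) 1)
  simp only [← eval_add, ← derivative_mul, ← hp, ← hq] at hsum
  rw [hi] at hsum
  have h1 : (ℓ i).eval 1 = if i = Fin.last p then 1 else 0 := hsp ▸ hval i (Fin.last p)
  simp only [eval_mul, hval, h1] at hsum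
  simp only [Matrix.mulVec, dotProduct, dgMatrix_apply hexact hdeg hval hL, sub_mul,
    sum_sub_distrib, mul_assoc]
  simp only [ite_mul, one_mul, zero_mul, mul_ite, mul_zero, sum_ite_eq, sum_ite_eq', mem_univ,
    if_true, hsp] at hsum ⊢
  split_ifs at hsum ⊢ with h
  · linarith
  · linarith

lemma dgMatrix_vecMul_eval (hs : Function.Injective s) (hsp : s (Fin.last p) = 1)
    (hexact : ∀ q : ℝ[X], q.natDegree ≤ 2 * p →
      ∑ i, ω i * q.eval (s i) = ∫ x in (-1:ℝ)..1, q.eval x)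
    (hdeg : ∀ i, (ℓ i).natDegree ≤ p)
    (hval : ∀ i j, (ℓ i).eval (s j) = if i = j then 1 else 0)
    (hL : ∀ i j, L i j =
      (∫ x in (-1:ℝ)..1, (derivative (ℓ i)).eval x * (ℓ j).eval x)
        - (if i = Fin.last p then (1:ℝ) else 0) * (if j = Fin.last p then (1:ℝ) else 0))
    {q : ℝ[X]} (hq : q.natDegree ≤ p) :
    Matrix.vecMul (fun i => q.eval (s i)) L =
      fun j => ω j * (derivative q).eval (s j) - if j = Fin.last p then q.eval 1 else 0 := by
  funext j
  have hd : (derivative q).eval (s j) = ∑ i, q.eval (s i) * (derivative (ℓ i)).eval (s j) := by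
    conv_lhs => rw [← sum_eval_mul_lagrange hs hdeg hval hq]
    simp [eval_finsetSum]
  rw [hd]
  simp only [Matrix.vecMul, dotProduct, dgMatrix_apply hexact hdeg hval hL, mul_sub,
    sum_sub_distrib, mul_sum]
  congr 1
  · exact sum_congr rfl fun i _ => by ring
  · simp [hsp]

end Radau

lemma collocation_defect_isBigO {ι : Type*} [Fintype ι] {A : Matrix ι ι ℝ} {c w : ι → ℝ}
    {u : ℝ → ℝ} {n N : ℕ} (hu : ContDiff ℝ (N + 1) u) (hn : n ≤ N)
    (hw : ∀ k < n, ∑ i, w i * (c i ^ (k + 1) - (k + 1) * ∑ j, A i j * c j ^ k) = 0) (t : ℝ) :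
    (fun h => ∑ i, w i * (u (t + h * c i) - u t - h * ∑ j, A i j * deriv u (t + h * c j)))
      =O[𝓝[>] 0] fun h => h ^ (n + 1) := by
  have hR := fun i => (taylor_sum_isBigO (n := N + 1) (by exact_mod_cast hu) t (c i)).trans
    (isBigO_pow_pow_nhdsGT_zero (show n + 1 ≤ N + 1 by omega))
  have hS := fun i => (taylor_sum_isBigO (contDiff_succ_iff_deriv.1 hu).2.2 t (c i)).trans
    (isBigO_pow_pow_nhdsGT_zero hn)
  have h1 : (fun h : ℝ => h) =O[𝓝[>] 0] fun h => h ^ 1 := by simpa using isBigO_refl _ _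
  have hSA := fun i => h1.mul_pow_nhdsGT_zero (n := n + 1)
    (IsBigO.fun_sum fun j (_ : j ∈ univ) => (hS j).const_mul_left (A i j)) (by omega)
  have hRS := IsBigO.fun_sum fun i (_ : i ∈ univ) => ((hR i).sub (hSA i)).const_mul_left (w i)
  have hT : (fun h : ℝ => ∑ k ∈ range N,
      (iteratedDeriv (k + 1) u t / ((k + 1).factorial : ℝ) *
        ∑ i, w i * (c i ^ (k + 1) - (k + 1) * ∑ j, A i j * c j ^ k)) * h ^ (k + 1))
      =O[𝓝[>] 0] fun h => h ^ (n + 1) := by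
    refine IsBigO.fun_sum fun k _ => ?_
    rcases lt_or_ge k n with hk | hk
    · simp only [hw k hk, mul_zero, zero_mul]
      exact isBigO_zero _ _
    · exact (isBigO_pow_pow_nhdsGT_zero (by omega)).const_mul_left _
  refine (hRS.add hT).congr_left fun h => ?_
  have hsum : ∑ k ∈ range N, (iteratedDeriv (k + 1) u t / ((k + 1).factorial : ℝ) *
        ∑ i, w i * (c i ^ (k + 1) - (k + 1) * ∑ j, A i j * c j ^ k)) * h ^ (k + 1) =
      ∑ i, w i * ((∑ k ∈ range N, iteratedDeriv (k + 1) u t / ((k + 1).factorial : ℝ) *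
          (h * c i) ^ (k + 1)) -
        h * ∑ j, A i j * ∑ k ∈ range N,
          iteratedDeriv k (deriv u) t / (k.factorial : ℝ) * (h * c j) ^ k) := by
    have hk : ∀ k i, iteratedDeriv (k + 1) u t / ((k + 1).factorial : ℝ) *
          (w i * (c i ^ (k + 1) - (k + 1) * ∑ j, A i j * c j ^ k)) * h ^ (k + 1) =
        w i * (iteratedDeriv (k + 1) u t / ((k + 1).factorial : ℝ) * (h * c i) ^ (k + 1)) -
        w i * (h * ∑ j, A i j * (iteratedDeriv k (deriv u) t / (k.factorial : ℝ) *
          (h * c j) ^ k)) := by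
      intro k i
      have hj : ∑ j, A i j * (iteratedDeriv k (deriv u) t / (k.factorial : ℝ) * (h * c j) ^ k) =
          iteratedDeriv (k + 1) u t / (k.factorial : ℝ) * h ^ k * ∑ j, A i j * c j ^ k := by
        rw [mul_sum, iteratedDeriv_succ']
        exact sum_congr rfl fun j _ => by ring
      have hfac : (k.factorial : ℝ) ≠ 0 := by positivity
      rw [hj, Nat.factorial_succ]
      push_cast
      field_simp
      ring
    simp only [mul_sum (s := univ) (f := fun i => w i * _), sum_mul (s := univ), hk]
    rw [sum_comm]
    refine sum_congr rfl fun i _ => ?_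
    rw [sum_sub_distrib, mul_sub, mul_sum]
    congr 1
    simp only [mul_sum]
    exact sum_comm
  rw [hsum, ← sum_add_distrib]
  refine sum_congr rfl fun i _ => ?_
  rw [sum_range_succ' _ N]
  simp only [mul_sub, sum_sub_distrib]
  simp only [pow_zero, Nat.factorial_zero, Nat.cast_one, div_one, mul_one, iteratedDeriv_zero]
  ring

/-- The monomial `t ^ k` on `[0, 1]` transported to `[-1, 1]` by `t = (x + 1) / 2`. -/
noncomputable def unitMonomial (k : ℕ) : ℝ[X] := (C (1 / 2) * (X + 1)) ^ k

lemma unitMonomial_eval (k : ℕ) (x : ℝ) : (unitMonomial k).eval x = ((x + 1) / 2) ^ k := by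
  simp only [unitMonomial, eval_pow, eval_mul, eval_C, eval_add, eval_X, eval_one]
  ring

lemma natDegree_unitMonomial_le (k : ℕ) : (unitMonomial k).natDegree ≤ k := by
  unfold unitMonomial
  refine natDegree_pow_le.trans ?_
  have : (C (1 / 2 : ℝ) * (X + 1)).natDegree ≤ 1 := by compute_degree
  nlinarith

lemma derivative_unitMonomial (k : ℕ) :
    derivative (unitMonomial (k + 1)) = C ((k + 1) / 2 : ℝ) * unitMonomial k := by
  unfold unitMonomial
  rw [derivative_pow_succ]
  have : derivative (C (1 / 2 : ℝ) * (X + 1)) = C (1 / 2) := by simp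
  rw [this, mul_right_comm, ← C_mul]
  congr 2
  ring

section Radau

variable {p : ℕ} {s ω : Fin (p + 1) → ℝ} {ℓ : Fin (p + 1) → ℝ[X]}
  {L : Matrix (Fin (p + 1)) (Fin (p + 1)) ℝ}

lemma radau_weight_moment
    (hexact : ∀ q : ℝ[X], q.natDegree ≤ 2 * p →
      ∑ i, ω i * q.eval (s i) = ∫ x in (-1:ℝ)..1, q.eval x)
    {k : ℕ} (hk : k ≤ 2 * p) : ∑ i, ω i / 2 * ((s i + 1) / 2) ^ k = 1 / (k + 1) := by
  have h := hexact (unitMonomial k) ((natDegree_unitMonomial_le k).trans hk)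
  have hI := integral_eval_derivative (unitMonomial (k + 1)) (-1) 1
  simp only [derivative_unitMonomial, eval_mul, eval_C,
    intervalIntegral.integral_const_mul, unitMonomial_eval] at hI h
  rw [← h] at hI
  norm_num at hI
  have : ∑ i, ω i / 2 * ((s i + 1) / 2) ^ k = (∑ i, ω i * ((s i + 1) / 2) ^ k) / 2 := by
    rw [sum_div]; exact sum_congr rfl fun i _ => by ring
  rw [this]
  have hk0 : (k + 1 : ℝ) ≠ 0 := by positivity
  field_simp
  linarith

end Radau

section InverseMatrix

variable {n : Type*} [Fintype n] [DecidableEq n] {L : Matrix n n ℝ} {v w : n → ℝ}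

lemma Matrix.inv_mulVec_eq_of_mulVec_eq (hL : IsUnit L.det) (h : L.mulVec v = w) :
    L⁻¹.mulVec w = v := by
  rw [← h, Matrix.mulVec_mulVec, Matrix.nonsing_inv_mul _ hL, Matrix.one_mulVec]

lemma Matrix.vecMul_inv_eq_of_vecMul_eq (hL : IsUnit L.det) (h : Matrix.vecMul v L = w) :
    Matrix.vecMul w L⁻¹ = v := by
  rw [← h, Matrix.vecMul_vecMul, Matrix.mul_nonsing_inv _ hL, Matrix.vecMul_one]

end InverseMatrix

section RungeKutta

/-- The Runge–Kutta coefficients on `[0, 1]` of the quadrature-based DG scheme. -/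
noncomputable def dgCoeff {n : Type*} [Fintype n] [DecidableEq n] (L : Matrix n n ℝ)
    (ω : n → ℝ) :
    Matrix n n ℝ :=
  Matrix.of fun i j => -(L⁻¹ i j * (ω j / 2))

variable {p : ℕ} {s ω : Fin (p + 1) → ℝ} {ℓ : Fin (p + 1) → ℝ[X]}
  {L : Matrix (Fin (p + 1)) (Fin (p + 1)) ℝ}

lemma dgCoeff_sum_pow (hsp : s (Fin.last p) = 1)
    (hexact : ∀ q : ℝ[X], q.natDegree ≤ 2 * p →
      ∑ i, ω i * q.eval (s i) = ∫ x in (-1:ℝ)..1, q.eval x)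
    (hdeg : ∀ i, (ℓ i).natDegree ≤ p)
    (hval : ∀ i j, (ℓ i).eval (s j) = if i = j then 1 else 0)
    (hL : ∀ i j, L i j =
      (∫ x in (-1:ℝ)..1, (derivative (ℓ i)).eval x * (ℓ j).eval x)
        - (if i = Fin.last p then (1:ℝ) else 0) * (if j = Fin.last p then (1:ℝ) else 0))
    (hLinv : IsUnit L.det) {k : ℕ} (hk : k ≤ p) (i : Fin (p + 1)) :
    ((s i + 1) / 2) ^ (k + 1) - (k + 1) * ∑ j, dgCoeff L ω i j * ((s j + 1) / 2) ^ k = 0 := by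
  have h := congrFun (Matrix.inv_mulVec_eq_of_mulVec_eq hLinv
    (dgMatrix_mulVec_eval hsp hexact hdeg hval hL
    (G := unitMonomial (k + 1)) ((natDegree_unitMonomial_le _).trans (by omega)))) i
  simp only [Matrix.mulVec, dotProduct, derivative_unitMonomial, eval_mul, eval_C,
    unitMonomial_eval] at h
  rw [← h, mul_sum, ← sum_sub_distrib]
  refine sum_eq_zero fun j _ => ?_
  simp only [dgCoeff, Matrix.of_apply]
  norm_num
  ring

lemma inv_mulVec_lagrange_eval_neg_one (hsp : s (Fin.last p) = 1)
    (hexact : ∀ q : ℝ[X], q.natDegree ≤ 2 * p →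
      ∑ i, ω i * q.eval (s i) = ∫ x in (-1:ℝ)..1, q.eval x)
    (hdeg : ∀ i, (ℓ i).natDegree ≤ p)
    (hval : ∀ i j, (ℓ i).eval (s j) = if i = j then 1 else 0)
    (hL : ∀ i j, L i j =
      (∫ x in (-1:ℝ)..1, (derivative (ℓ i)).eval x * (ℓ j).eval x)
        - (if i = Fin.last p then (1:ℝ) else 0) * (if j = Fin.last p then (1:ℝ) else 0))
    (hLinv : IsUnit L.det) (a : ℝ) :
    L⁻¹.mulVec (fun i => a * (ℓ i).eval (-1)) = fun _ => -a := by
  refine Matrix.inv_mulVec_eq_of_mulVec_eq hLinv ?_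
  have h := dgMatrix_mulVec_eval hsp hexact hdeg hval hL (G := C (-a)) (by simp)
  simpa [mul_comm a] using h

lemma sum_mul_dgCoeff (hs : Function.Injective s) (hsp : s (Fin.last p) = 1)
    (hexact : ∀ q : ℝ[X], q.natDegree ≤ 2 * p →
      ∑ i, ω i * q.eval (s i) = ∫ x in (-1:ℝ)..1, q.eval x)
    (hdeg : ∀ i, (ℓ i).natDegree ≤ p)
    (hval : ∀ i j, (ℓ i).eval (s j) = if i = j then 1 else 0)
    (hL : ∀ i j, L i j =
      (∫ x in (-1:ℝ)..1, (derivative (ℓ i)).eval x * (ℓ j).eval x)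
        - (if i = Fin.last p then (1:ℝ) else 0) * (if j = Fin.last p then (1:ℝ) else 0))
    (hLinv : IsUnit L.det) {k : ℕ} (hk : k < p) (j : Fin (p + 1)) :
    ∑ m, ω m / 2 * ((s m + 1) / 2) ^ k * dgCoeff L ω m j =
      ω j / 2 * (1 - ((s j + 1) / 2) ^ (k + 1)) / (k + 1) := by
  have hq : (1 - unitMonomial (k + 1)).natDegree ≤ p :=
    (natDegree_sub_le _ _).trans (by
      have := natDegree_unitMonomial_le (k + 1)
      simp only [natDegree_one, max_le_iff]; omega)
  have h := congrFun (Matrix.vecMul_inv_eq_of_vecMul_eq hLinv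
    (dgMatrix_vecMul_eval hs hsp hexact hdeg hval hL hq)) j
  simp only [Matrix.vecMul, dotProduct, derivative_sub, derivative_one, derivative_unitMonomial,
    eval_sub, eval_mul, eval_C, eval_one, eval_zero, unitMonomial_eval] at h
  rw [← h, mul_sum, sum_div]
  refine sum_congr rfl fun m _ => ?_
  have hk0 : (k + 1 : ℝ) ≠ 0 := by positivity
  simp only [dgCoeff, Matrix.of_apply]
  norm_num
  field_simp

lemma dgCoeff_last (hs : Function.Injective s) (hsp : s (Fin.last p) = 1)
    (hexact : ∀ q : ℝ[X], q.natDegree ≤ 2 * p →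
      ∑ i, ω i * q.eval (s i) = ∫ x in (-1:ℝ)..1, q.eval x)
    (hdeg : ∀ i, (ℓ i).natDegree ≤ p)
    (hval : ∀ i j, (ℓ i).eval (s j) = if i = j then 1 else 0)
    (hL : ∀ i j, L i j =
      (∫ x in (-1:ℝ)..1, (derivative (ℓ i)).eval x * (ℓ j).eval x)
        - (if i = Fin.last p then (1:ℝ) else 0) * (if j = Fin.last p then (1:ℝ) else 0))
    (hLinv : IsUnit L.det) (j : Fin (p + 1)) :
    dgCoeff L ω (Fin.last p) j = ω j / 2 := by
  have h := congrFun (Matrix.vecMul_inv_eq_of_vecMul_eq hLinv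
    (dgMatrix_vecMul_eval hs hsp hexact hdeg hval hL (q := 1) (by simp))) j
  simp [Matrix.vecMul, dotProduct] at h
  simp only [dgCoeff, Matrix.of_apply]
  linear_combination (-ω j / 2) * (-h)

lemma dgCoeff_weighted_defect_eq_zero (hs : Function.Injective s) (hsp : s (Fin.last p) = 1)
    (hexact : ∀ q : ℝ[X], q.natDegree ≤ 2 * p →
      ∑ i, ω i * q.eval (s i) = ∫ x in (-1:ℝ)..1, q.eval x)
    (hdeg : ∀ i, (ℓ i).natDegree ≤ p)
    (hval : ∀ i j, (ℓ i).eval (s j) = if i = j then 1 else 0)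
    (hL : ∀ i j, L i j =
      (∫ x in (-1:ℝ)..1, (derivative (ℓ i)).eval x * (ℓ j).eval x)
        - (if i = Fin.last p then (1:ℝ) else 0) * (if j = Fin.last p then (1:ℝ) else 0))
    (hLinv : IsUnit L.det) {i k : ℕ} (hi : i < p) (hk : k < 2 * p - i) :
    ∑ m, ω m / 2 * ((s m + 1) / 2) ^ i * (((s m + 1) / 2) ^ (k + 1) -
      (k + 1) * ∑ j, dgCoeff L ω m j * ((s j + 1) / 2) ^ k) = 0 := by
  have h1 := radau_weight_moment hexact (k := i + k + 1) (by omega)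
  have h2 := radau_weight_moment hexact (k := k) (by omega)
  have h3 : ∑ m, ω m / 2 * ((s m + 1) / 2) ^ i * ∑ j, dgCoeff L ω m j * ((s j + 1) / 2) ^ k
      = (1 / (k + 1) - 1 / ((i + k + 1 : ℕ) + 1)) / (i + 1) := by
    rw [← h1, ← h2, ← sum_sub_distrib, sum_div]
    simp only [mul_sum]
    rw [sum_comm]
    refine sum_congr rfl fun j _ => ?_
    have := sum_mul_dgCoeff hs hsp hexact hdeg hval hL hLinv hi j
    simp only [← mul_assoc]
    rw [← sum_mul, this]
    ring
  have h4 : ∀ m, ω m / 2 * ((s m + 1) / 2) ^ i * (((s m + 1) / 2) ^ (k + 1) -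
      (k + 1) * ∑ j, dgCoeff L ω m j * ((s j + 1) / 2) ^ k) =
      ω m / 2 * ((s m + 1) / 2) ^ (i + k + 1) - (k + 1) * (ω m / 2 * ((s m + 1) / 2) ^ i *
        ∑ j, dgCoeff L ω m j * ((s j + 1) / 2) ^ k) := fun m => by ring
  simp only [h4]
  rw [sum_sub_distrib, ← mul_sum, h1, h3]
  push_cast
  have : (i + 1 : ℝ) ≠ 0 := by positivity
  have : (k + 1 : ℝ) ≠ 0 := by positivity
  have : (i + k + 1 + 1 : ℝ) ≠ 0 := by positivity
  field_simp
  ring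

end RungeKutta

lemma increment_linearization_isBigO {p : ℕ} {f : ℝ → ℝ → ℝ}
    (hf : ContDiff ℝ (2 * p + 1) (Function.uncurry f)) {u : ℝ → ℝ} (hu : ContDiff ℝ p u)
    {t c : ℝ} {v : ℝ → ℝ} {k : ℕ}
    (hv : (fun h => u (t + h * c) - v h) =O[𝓝[>] 0] fun h => h ^ min (p + 2) (k + 2))
    (hd : (fun h => f (t + h * c) (u (t + h * c)) - f (t + h * c) (v h)) =O[𝓝[>] 0]
      fun h => u (t + h * c) - v h) :
    (fun h => f (t + h * c) (u (t + h * c)) - f (t + h * c) (v h) -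
        (∑ l ∈ range p, iteratedDeriv l
          (fun t => fderiv ℝ (Function.uncurry f) (t, u t) (0, 1)) t / (l.factorial : ℝ) *
            (h * c) ^ l) * (u (t + h * c) - v h))
      =O[𝓝[>] 0] fun h => h ^ min (2 * p + 1) (k + 2) := by
  rcases Nat.eq_zero_or_pos p with rfl | hp
  · simp only [range_zero, sum_empty, zero_mul, sub_zero]
    exact (hd.trans hv).trans (isBigO_pow_pow_nhdsGT_zero (by omega))
  set a : ℝ → ℝ := fun t => fderiv ℝ (Function.uncurry f) (t, u t) (0, 1) with ha
  have hac : ContDiff ℝ p a := by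
    have h1 : ContDiff ℝ p (fderiv ℝ (Function.uncurry f)) :=
      hf.fderiv_right (by norm_cast; omega)
    exact (h1.comp (contDiff_id.prodMk hu)).clm_apply contDiff_const
  have htc : Tendsto (fun h : ℝ => t + h * c) (𝓝[>] 0) (𝓝 t) := by
    have hc : Continuous fun h : ℝ => t + h * c := by fun_prop
    simpa using (hc.tendsto 0).mono_left nhdsWithin_le_nhds
  have hut : Tendsto (fun h : ℝ => u (t + h * c)) (𝓝[>] 0) (𝓝 (u t)) :=
    (hu.continuous.tendsto t).comp htc
  have he0 : Tendsto (fun h : ℝ => u (t + h * c) - v h) (𝓝[>] 0) (𝓝 0) := by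
    refine hv.trans_tendsto ?_
    have hc : Continuous fun h : ℝ => h ^ min (p + 2) (k + 2) := by fun_prop
    simpa using (hc.tendsto 0).mono_left nhdsWithin_le_nhds
  have hvt : Tendsto v (𝓝[>] 0) (𝓝 (u t)) := by simpa using hut.sub he0
  have hF : ContDiffAt ℝ 2 (Function.uncurry f) (t, u t) :=
    (hf.of_le (by norm_cast; omega)).contDiffAt
  have hq := hF.isBigO_sub_sub_fderiv (htc.prodMk_nhds hut) (htc.prodMk_nhds hvt)
  have hlin : ∀ h, fderiv ℝ (Function.uncurry f) (t + h * c, u (t + h * c))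
      (0, v h - u (t + h * c)) = (v h - u (t + h * c)) * a (t + h * c) := fun h => by
    have hz : ((0, v h - u (t + h * c)) : ℝ × ℝ) = (v h - u (t + h * c)) • (0, 1) := by simp
    rw [hz, map_smul, smul_eq_mul]
  simp only [Prod.mk_sub_mk, sub_self, hlin, Function.uncurry_apply_pair, Prod.norm_mk,
    norm_zero, norm_nonneg, sup_of_le_right] at hq
  have hv2 : (fun h => ‖v h - u (t + h * c)‖ ^ 2) =O[𝓝[>] 0]
      fun h => h ^ min (2 * p + 1) (k + 2) := by
    have := hv.norm_left
    simp only [norm_sub_rev (u _)] at this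
    simp only [pow_two]
    exact this.mul_pow_nhdsGT_zero this (by omega)
  have hT := (taylor_sum_isBigO hac t c).mul_pow_nhdsGT_zero hv
    (n := min (2 * p + 1) (k + 2)) (by omega)
  refine (hT.sub (hq.trans hv2)).congr_left fun h => ?_
  ring

/-- DG-Ex2, local truncation error: For the quadrature-based explicit DG
iteration (Gauß–Radau quadrature exact for degree `2p`, `L` invertible, `f` of class
`C^{2p+1}` and globally Lipschitz in its second argument, `u` the exact solution with
`u(t_n) = u_n`), for each fixed `K` there are `C > 0` and `h₀ > 0` such that for all
`0 < h ≤ h₀`: `|u(t_{n,m}) - U^K_m| ≤ C h^{min(p+2, K+2)}` for `0 ≤ m ≤ p-1` and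
`|u(t_n + h) - U^K_p| ≤ C h^{min(2p+2, K+2)}`. -/
theorem dg_explicit_local_truncation_error (p : ℕ) (s ω : Fin (p + 1) → ℝ)
    (hs : StrictMono s) (hs0 : (-1 : ℝ) < s 0) (hsp : s (Fin.last p) = 1)
    (hω : ∀ i, 0 < ω i)
    (hexact : ∀ q : Polynomial ℝ, q.natDegree ≤ 2 * p →
      ∑ i, ω i * q.eval (s i) = ∫ x in (-1:ℝ)..1, q.eval x)
    (ℓ : Fin (p + 1) → Polynomial ℝ)
    (hdeg : ∀ i, (ℓ i).natDegree ≤ p)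
    (hval : ∀ i j, (ℓ i).eval (s j) = if i = j then 1 else 0)
    (L : Matrix (Fin (p + 1)) (Fin (p + 1)) ℝ)
    (hLdef : ∀ i j, L i j =
      (∫ x in (-1:ℝ)..1, (Polynomial.derivative (ℓ i)).eval x * (ℓ j).eval x)
        - (if i = Fin.last p then (1:ℝ) else 0) * (if j = Fin.last p then (1:ℝ) else 0))
    (hLinv : IsUnit L.det)
    (f : ℝ → ℝ → ℝ) (Λ : NNReal)
    (hf : ContDiff ℝ (2 * p + 1) (Function.uncurry f))
    (hLip : ∀ t, LipschitzWith Λ (f t))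
    (u : ℝ → ℝ) (hu : ∀ t, HasDerivAt u (f t (u t)) t)
    (tn un : ℝ) (hun : u tn = un)
    (B : Fin (p + 1) → ℝ) (hB : ∀ i, B i = un * (ℓ i).eval (-1))
    (Fω : ℝ → (Fin (p + 1) → ℝ) → Fin (p + 1) → ℝ)
    (hFω : ∀ h U j, Fω h U j = ω j * f (tn + h / 2 * (s j + 1)) (U j))
    (U : ℝ → ℕ → Fin (p + 1) → ℝ)
    (hU0 : ∀ h m, U h 0 m = un + (h / 2 * (s m + 1)) * f tn un)
    (hUk : ∀ h k, U h (k + 1) = -((h / 2) • L⁻¹.mulVec (Fω h (U h k))) - L⁻¹.mulVec B)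
    (K : ℕ) :
    ∃ C > 0, ∃ h₀ > 0, ∀ h : ℝ, 0 < h → h ≤ h₀ →
      (∀ m : Fin (p + 1), (m : ℕ) < p →
        |u (tn + h / 2 * (s m + 1)) - U h K m| ≤ C * h ^ (min (p + 2) (K + 2))) ∧
      |u (tn + h) - U h K (Fin.last p)| ≤ C * h ^ (min (2 * p + 2) (K + 2)) := by
  set c : Fin (p + 1) → ℝ := fun i => (s i + 1) / 2 with hc
  have hnode : ∀ h i, h / 2 * (s i + 1) = h * c i := fun h i => by simp only [hc]; ring
  have hclast : c (Fin.last p) = 1 := by simp only [hc, hsp]; norm_num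
  simp only [hnode] at hFω hU0 ⊢
  have hinj := hs.injective
  set A := dgCoeff L ω with hAdef
  have huC : ContDiff ℝ ((2 * p + 1 : ℕ) + 1) u :=
    contDiff_succ_of_hasDerivAt (by exact_mod_cast hf) hu
  have hdu : ∀ t, deriv u t = f t (u t) := fun t => (hu t).deriv
  have hstep : ∀ h k i, U h (k + 1) i = un + h * ∑ j, A i j * f (tn + h * c j) (U h k j) := by
    intro h k i
    have hLB : L⁻¹.mulVec B = fun _ => -un := by
      rw [funext hB]
      exact inv_mulVec_lagrange_eval_neg_one hsp hexact hdeg hval hLdef hLinv un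
    rw [hUk, hLB]
    simp only [Pi.sub_apply, Pi.neg_apply, Pi.smul_apply, Matrix.mulVec, dotProduct, hFω,
      smul_eq_mul, hAdef, dgCoeff, Matrix.of_apply, mul_sum]
    rw [← sum_neg_distrib, sub_neg_eq_add, add_comm]
    exact congrArg _ (sum_congr rfl fun j _ => by ring)
  set e : ℕ → Fin (p + 1) → ℝ → ℝ := fun k i h => u (tn + h * c i) - U h k i with he
  set d : ℕ → Fin (p + 1) → ℝ → ℝ := fun k i h =>
    f (tn + h * c i) (u (tn + h * c i)) - f (tn + h * c i) (U h k i) with hd_def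
  set δ : Fin (p + 1) → ℝ → ℝ := fun i h =>
    u (tn + h * c i) - u tn - h * ∑ j, A i j * deriv u (tn + h * c j) with hδ_def
  have hrec : ∀ k i h, e (k + 1) i h = h * ∑ j, A i j * d k j h + δ i h := by
    intro k i h
    simp only [he, hd_def, hδ_def, hstep, hdu, mul_sub, sum_sub_distrib, hun]
    ring
  have he0 : ∀ i, e 0 i =O[𝓝[>] 0] fun h => h ^ 2 := fun i => by
    have huC2 : ContDiff ℝ (2 : ℕ) u := huC.of_le (by norm_cast; omega)
    refine (taylor_sum_isBigO huC2 tn (c i)).congr_left fun h => ?_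
    simp [he, hU0, sum_range_succ, hdu, hun]
    ring
  have hd : ∀ k j, d k j =O[𝓝[>] 0] e k j := fun k j =>
    IsBigO.of_bound Λ (Eventually.of_forall fun h => (hLip _).norm_sub_le _ _)
  have hdefect := fun {n : ℕ} {w : Fin (p + 1) → ℝ} (hn : n ≤ 2 * p + 1) hw =>
    collocation_defect_isBigO (A := A) (c := c) (w := w) huC hn hw tn
  have hδ : ∀ i, δ i =O[𝓝[>] 0] fun h => h ^ (p + 2) := fun i => by
    have h1 := hdefect (n := p + 1) (w := Pi.single i 1) (by omega) (fun k hk => by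
      simpa [Pi.single_apply] using
        dgCoeff_sum_pow hsp hexact hdeg hval hLdef hLinv (Nat.lt_succ_iff.1 hk) i)
    simpa [Pi.single_apply] using h1
  have hAlast := dgCoeff_last hinj hsp hexact hdeg hval hLdef hLinv
  have hδlast : δ (Fin.last p) =O[𝓝[>] 0] fun h => h ^ (2 * p + 2) := by
    have h1 := hdefect (n := 2 * p + 1) (w := Pi.single (Fin.last p) 1) le_rfl (fun k hk => by
      have hk0 : (k + 1 : ℝ) ≠ 0 := by positivity
      have h2 := radau_weight_moment hexact (Nat.lt_succ_iff.1 hk)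
      simp only [Pi.single_apply, ite_mul, one_mul, zero_mul, sum_ite_eq', mem_univ, if_true,
        hclast, one_pow, hAdef, hAlast]
      rw [h2]
      field_simp
      ring)
    simpa [Pi.single_apply] using h1
  have hδm : ∀ i < p, (fun h => ∑ j, ω j / 2 * c j ^ i * δ j h)
      =O[𝓝[>] 0] fun h => h ^ (2 * p + 1 - i) := fun i hi => by
    have h1 := hdefect (n := 2 * p - i) (w := fun m => ω m / 2 * c m ^ i) (by omega)
      (fun k hk => dgCoeff_weighted_defect_eq_zero hinj hsp hexact hdeg hval hLdef hLinv hi hk)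
    rwa [show 2 * p - i + 1 = 2 * p + 1 - i by omega] at h1
  have hstage := stage_error_isBigO hrec he0 hd hδ
  have hend := endpoint_error_isBigO hrec he0 hd hδ
    (fun k j => increment_linearization_isBigO hf (huC.of_le (by norm_cast; omega))
      (hstage k j) (hd k j))
    (fun i hi j => sum_mul_dgCoeff hinj hsp hexact hdeg hval hLdef hLinv hi j)
    hδm hAlast hδlast K
  choose C hC using fun i => (hstage K i).bound
  obtain ⟨Ce, hCe⟩ := hend.bound
  have hall := (eventually_all.2 hC).and hCe
  obtain ⟨r, hr, hrs⟩ := mem_nhdsGT_iff_exists_Ioc_subset.1 hall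
  have hsum : ∀ i, C i ≤ ∑ i, |C i| := fun i => (le_abs_self _).trans
    (single_le_sum (f := fun i => |C i|) (fun j _ => abs_nonneg _) (mem_univ i))
  have hnn : 0 ≤ ∑ i, |C i| := sum_nonneg fun _ _ => abs_nonneg _
  refine ⟨∑ i, |C i| + |Ce| + 1, by positivity, r, hr, fun h h0 hh => ?_⟩
  obtain ⟨h1, h2⟩ := hrs ⟨h0, hh⟩
  simp only [norm_pow, Real.norm_eq_abs, abs_of_pos h0, he] at h1 h2
  refine ⟨fun m _ => (h1 m).trans ?_, ?_⟩
  · gcongr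
    linarith [hsum m, abs_nonneg Ce]
  · rw [hclast, mul_one] at h2
    refine h2.trans ?_
    gcongr
    linarith [le_abs_self Ce]
end
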